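/- arXiv:1609.09245 — 14 statements merged into one kernel-verified Lean document; each statement's English description precedes it below -/
import Mathlib

section
/- Let T be a real 2×2×2 tensor, i.e. a function T : Fin 2 → Fin 2 → Fin 2 → ℝ. Then T lies in the closure (in the standard Euclidean topology on the 8-dimensional space of such tensors) of the set of tensors of real rank at most two if and only if Det(T) ≥ 0. -/
/-- The hyperdeterminant of a real 2×2×2 tensor. -/
def Det222 (T : Fin 2 → Fin 2 → Fin 2 → ℝ) : ℝ :=
    (T 0 0 0)^2 * (T 1 1 1)^2 + (T 0 0 1)^2 * (T 1 1 0)^2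
  + (T 0 1 0)^2 * (T 1 0 1)^2 + (T 0 1 1)^2 * (T 1 0 0)^2
  + 4 * T 0 0 0 * T 0 1 1 * T 1 0 1 * T 1 1 0
  + 4 * T 0 0 1 * T 0 1 0 * T 1 0 0 * T 1 1 1
  - 2 * T 0 0 0 * T 0 0 1 * T 1 1 0 * T 1 1 1
  - 2 * T 0 0 0 * T 0 1 0 * T 1 0 1 * T 1 1 1
  - 2 * T 0 0 0 * T 0 1 1 * T 1 0 0 * T 1 1 1
  - 2 * T 0 0 1 * T 0 1 0 * T 1 0 1 * T 1 1 0
  - 2 * T 0 0 1 * T 0 1 1 * T 1 0 0 * T 1 1 0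
  - 2 * T 0 1 0 * T 0 1 1 * T 1 0 0 * T 1 0 1

/-- The hyperdeterminant of a sum of two simple tensors is a square. -/
lemma Det222_nonneg_of_sum_two (T : Fin 2 → Fin 2 → Fin 2 → ℝ) (a b c d e f : Fin 2 → ℝ)
    (h : ∀ i j k, T i j k = a i * b j * c k + d i * e j * f k) : 0 ≤ Det222 T := by
  have : Det222 T = ((a 0 * d 1 - a 1 * d 0) * (b 0 * e 1 - b 1 * e 0)
      * (c 0 * f 1 - c 1 * f 0)) ^ 2 := by
    simp only [Det222, h]
    ring
  rw [this]
  positivity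

lemma continuous_Det222 : Continuous Det222 := by
  unfold Det222
  fun_prop

/-- A singular `2 × 2` array is an outer product. -/
lemma exists_outer_of_det_eq_zero (M : Fin 2 → Fin 2 → ℝ)
    (h : M 0 0 * M 1 1 - M 0 1 * M 1 0 = 0) :
    ∃ b c : Fin 2 → ℝ, ∀ j k, M j k = b j * c k := by
  by_cases h0 : M 0 0 = 0
  · by_cases h1 : M 0 1 = 0
    · refine ⟨![0, 1], M 1, fun j k => ?_⟩
      fin_cases j <;> fin_cases k <;> simp [h0, h1]
    · refine ⟨![1, M 1 1 / M 0 1], M 0, fun j k => ?_⟩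
      fin_cases j <;> fin_cases k <;> simp <;> field_simp
      linarith
  · refine ⟨![1, M 1 0 / M 0 0], M 0, fun j k => ?_⟩
    fin_cases j <;> fin_cases k <;> simp <;> field_simp
    linarith

/-- A binary quadratic form of positive discriminant has two independent real zeros. -/
lemma exists_independent_zeros_of_discrim_pos (α β γ : ℝ) (h : 0 < discrim α β γ) :
    ∃ p q r s : ℝ, p * s - q * r ≠ 0 ∧ α * p ^ 2 + β * p * q + γ * q ^ 2 = 0 ∧
      α * r ^ 2 + β * r * s + γ * s ^ 2 = 0 := by
  unfold discrim at h
  by_cases hα : α = 0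
  · subst hα
    have hβ : β ≠ 0 := by
      rintro rfl
      simp at h
    exact ⟨1, 0, γ, -β, by simpa using hβ, by ring, by ring⟩
  · have hs := Real.sq_sqrt h.le
    have hpos := Real.sqrt_pos.2 h
    set D := √(β ^ 2 - 4 * α * γ)
    refine ⟨-β + D, 2 * α, -β - D, 2 * α, ?_, ?_, ?_⟩
    · have : (-β + D) * (2 * α) - 2 * α * (-β - D) = 4 * α * D := by ring
      rw [this]
      positivity
    · linear_combination α * hs
    · linear_combination α * hs

/-- A real tensor of positive hyperdeterminant has real rank at most two. -/
lemma exists_sum_two_of_Det222_pos (T : Fin 2 → Fin 2 → Fin 2 → ℝ) (h : 0 < Det222 T) :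
    ∃ a b c d e f : Fin 2 → ℝ, ∀ i j k, T i j k = a i * b j * c k + d i * e j * f k := by
  obtain ⟨p, q, r, s, hne, h₁, h₂⟩ := exists_independent_zeros_of_discrim_pos
    (T 0 0 0 * T 0 1 1 - T 0 0 1 * T 0 1 0)
    (T 0 0 0 * T 1 1 1 + T 1 0 0 * T 0 1 1 - T 0 0 1 * T 1 1 0 - T 1 0 1 * T 0 1 0)
    (T 1 0 0 * T 1 1 1 - T 1 0 1 * T 1 1 0)
    (h.trans_eq (by unfold Det222 discrim; ring))
  obtain ⟨b, c, hbc⟩ := exists_outer_of_det_eq_zero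
    (fun j k => p * T 0 j k + q * T 1 j k) (by linear_combination h₁)
  obtain ⟨e, f, hef⟩ := exists_outer_of_det_eq_zero
    (fun j k => r * T 0 j k + s * T 1 j k) (by linear_combination h₂)
  refine ⟨![s / (p * s - q * r), -r / (p * s - q * r)], b, c,
    ![-q / (p * s - q * r), p / (p * s - q * r)], e, f, fun i j k => ?_⟩
  have hM := hbc j k
  have hN := hef j k
  rw [mul_assoc, mul_assoc, ← hM, ← hN]
  generalize hD : p * s - q * r = D at hne ⊢
  fin_cases i <;> simp <;> field_simp <;> rw [← hD] <;> ring

/-- In the direction of the coordinate opposite to `(i, j, k)`, the hyperdeterminant is a quadratic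
polynomial with leading coefficient `T i j k ^ 2`. -/
lemma exists_direction_Det222_quadratic (T : Fin 2 → Fin 2 → Fin 2 → ℝ) (i j k : Fin 2) :
    ∃ (S : Fin 2 → Fin 2 → Fin 2 → ℝ) (g : ℝ), ∀ x : ℝ,
      Det222 (T + x • S) = Det222 T + g * x + T i j k ^ 2 * x ^ 2 := by
  let S : Fin 2 → Fin 2 → Fin 2 → ℝ :=
    Pi.single (1 - i) (Pi.single (1 - j) (Pi.single (1 - k) 1))
  refine ⟨S, Det222 (T + S) - Det222 T - T i j k ^ 2, fun x => ?_⟩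
  fin_cases i <;> fin_cases j <;> fin_cases k <;>
    simp [S, Det222] <;> ring

open Filter Topology in
/-- A nonzero tensor of vanishing hyperdeterminant is a limit of tensors of positive
hyperdeterminant. -/
lemma mem_closure_Det222_pos (T : Fin 2 → Fin 2 → Fin 2 → ℝ) (h : Det222 T = 0) (hT : T ≠ 0) :
    T ∈ closure {S | 0 < Det222 S} := by
  obtain ⟨i, j, k, hijk⟩ : ∃ i j k, T i j k ≠ 0 := by
    by_contra! H
    exact hT (by ext i j k; exact H i j k)
  obtain ⟨S, g, hg⟩ := exists_direction_Det222_quadratic T i j k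
  obtain ⟨σ, hσ, hgσ⟩ : ∃ σ : ℝ, σ ≠ 0 ∧ 0 ≤ g * σ := by
    rcases le_total 0 g with h0 | h0
    · exact ⟨1, one_ne_zero, by simpa using h0⟩
    · exact ⟨-1, by norm_num, by simpa using h0⟩
  have hlim : Tendsto (fun x : ℝ => T + (σ * x) • S) (𝓝[>] 0) (𝓝 T) := by
    have hc : Continuous fun x : ℝ => T + (σ * x) • S := by fun_prop
    simpa using (hc.tendsto 0).mono_left nhdsWithin_le_nhds
  refine mem_closure_of_tendsto hlim ?_
  filter_upwards [self_mem_nhdsWithin] with x hx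
  have hx : 0 < x := hx
  have hquad : 0 < T i j k ^ 2 * (σ * x) ^ 2 := by positivity
  have hlin : 0 ≤ g * (σ * x) := by
    rw [← mul_assoc]
    positivity
  rw [hg, h]
  linarith

/-- A real 2×2×2 tensor lies in the closure of the set of tensors of real rank at most two
if and only if its hyperdeterminant is non-negative. -/
theorem realRankTwo_closure_iff_hyperdet_nonneg (T : Fin 2 → Fin 2 → Fin 2 → ℝ) :
    T ∈ closure {S : Fin 2 → Fin 2 → Fin 2 → ℝ |
      ∃ a b c d e f : Fin 2 → ℝ, ∀ i j k, S i j k = a i * b j * c k + d i * e j * f k}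
    ↔ 0 ≤ Det222 T := by
  constructor
  · intro hT
    refine closure_minimal ?_ (isClosed_le continuous_const continuous_Det222) hT
    rintro S ⟨a, b, c, d, e, f, h⟩
    exact Det222_nonneg_of_sum_two S a b c d e f h
  · intro h
    rcases h.lt_or_eq with hpos | hzero
    · exact subset_closure (exists_sum_two_of_Det222_pos T hpos)
    · by_cases hT : T = 0
      · exact subset_closure ⟨0, 0, 0, 0, 0, 0, by simp [hT]⟩
      · exact closure_mono exists_sum_two_of_Det222_pos (mem_closure_Det222_pos T hzero.symm hT)
end

section
/- Let a, b, c, d, e, f : Fin 2 → ℝ and let T be the 2×2×2 real tensor defined by T i j k = a i * b j * c k + d i * e j * f k. Then Det(T) = (a 0 * d 1 − a 1 * d 0)² * (b 0 * e 1 − b 1 * e 0)² * (c 0 * f 1 − c 1 * f 0)². -/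
/-- The hyperdeterminant of a real rank-two 2×2×2 tensor is a product of three squares. -/
theorem hyperdet_of_rank_two (a b c d e f : Fin 2 → ℝ)
    (T : Fin 2 → Fin 2 → Fin 2 → ℝ)
    (hT : ∀ i j k, T i j k = a i * b j * c k + d i * e j * f k) :
    Det222 T = (a 0 * d 1 - a 1 * d 0)^2 * (b 0 * e 1 - b 1 * e 0)^2 *
      (c 0 * f 1 - c 1 * f 0)^2 := by
  simp only [Det222, hT]
  ring
end

section
/- Let a, A, b, B, c, C : Fin 2 → ℝ and let T be the 2×2×2 real tensor defined by T i j k = 2 * Re( (a i + A i * I) * (b j + B j * I) * (c k + C k * I) ), where I = √−1 in ℂ. Then Det(T) = −64 * (a 0 * A 1 − a 1 * A 0)² * (b 0 * B 1 − b 1 * B 0)² * (c 0 * C 1 − c 1 * C 0)². -/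
/-- The hyperdeterminant of the real 2×2×2 tensor which is the sum of a complex rank-one
tensor and its complex conjugate is minus 64 times a product of three squares. -/
theorem hyperdet_of_complex_conjugate_pair (a A b B c C : Fin 2 → ℝ)
    (T : Fin 2 → Fin 2 → Fin 2 → ℝ)
    (hT : ∀ i j k, T i j k =
      2 * (((a i : ℂ) + A i * Complex.I) * ((b j : ℂ) + B j * Complex.I) *
        ((c k : ℂ) + C k * Complex.I)).re) :
    Det222 T = -64 * (a 0 * A 1 - a 1 * A 0)^2 * (b 0 * B 1 - b 1 * B 0)^2 *
      (c 0 * C 1 - c 1 * C 0)^2 := by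
  have hre : ∀ i j k, T i j k =
      2 * ((a i * b j - A i * B j) * c k - (a i * B j + A i * b j) * C k) := by
    intro i j k
    rw [hT]
    simp
  simp only [Det222, hre]
  ring
end

section
/- Let d ≥ 3 and n : Fin d → ℕ with n i ≥ 1 for all i, and let T : (∀ i : Fin d, Fin (n i)) → ℝ be a real tensor. Then T has real border rank at most two if and only if every flattening of T has matrix rank at most 2 and every 2×2×2 sub-hyperdeterminant of T is non-negative. -/
/-- The flattening of a tensor at a set `S` of axes: the matrix whose rows are indexed by
multi-indices along the axes in `S` and whose columns are indexed by multi-indices along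
the remaining axes. -/
def flattening {d : ℕ} {n : Fin d → ℕ} (T : (∀ i : Fin d, Fin (n i)) → ℝ)
    (S : Finset (Fin d)) :
    Matrix (∀ i : {i : Fin d // i ∈ S}, Fin (n i.1)) (∀ i : {i : Fin d // i ∉ S}, Fin (n i.1)) ℝ :=
  fun r c => T (fun i => if h : i ∈ S then r ⟨i, h⟩ else c ⟨i, h⟩)

/-- The 2×2×2 sub-tensor of a tensor `T` obtained by choosing three axes `i₁, i₂, i₃`,
a pair of indices along each of these axes, and a fixed multi-index `j₀` for all other axes. -/
def subTensor222 {d : ℕ} {n : Fin d → ℕ} (T : (∀ i : Fin d, Fin (n i)) → ℝ)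
    (i₁ i₂ i₃ : Fin d) (u : Fin 2 → Fin (n i₁)) (v : Fin 2 → Fin (n i₂))
    (w : Fin 2 → Fin (n i₃)) (j₀ : ∀ i : Fin d, Fin (n i)) :
    Fin 2 → Fin 2 → Fin 2 → ℝ :=
  fun p q r =>
    T (Function.update (Function.update (Function.update j₀ i₁ (u p)) i₂ (v q)) i₃ (w r))

theorem Matrix.exists_eq_add_of_rank_le_two {α β : Type*} [Fintype α] [Fintype β]
    (M : Matrix α β ℝ) (hM : M.rank ≤ 2) :
    ∃ (U : Fin 2 → α → ℝ) (V : Fin 2 → β → ℝ), ∀ a b, M a b = U 0 a * V 0 b + U 1 a * V 1 b := by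
  classical
  obtain ⟨f, hf⟩ := (finrank_le_iff_exists_linearMap (R := ℝ)
    (M := LinearMap.range M.mulVecLin) (M' := Fin 2 → ℝ)).1 (by simpa [Matrix.rank] using hM)
  obtain ⟨g, hg⟩ := f.exists_leftInverse_of_injective (LinearMap.ker_eq_bot.2 hf)
  refine ⟨fun k a => (g (Pi.single k 1) : α → ℝ) a,
    fun k b => f (M.mulVecLin.rangeRestrict (Pi.single b 1)) k, fun a b => ?_⟩
  have h := LinearMap.congr_fun hg (M.mulVecLin.rangeRestrict (Pi.single b 1))
  have h2 := congrArg (fun x : LinearMap.range M.mulVecLin => (x : α → ℝ) a) h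
  simp only [LinearMap.comp_apply, LinearMap.id_apply] at h2
  set y := f (M.mulVecLin.rangeRestrict (Pi.single b 1))
  have hy : y = y 0 • Pi.single 0 1 + y 1 • Pi.single 1 1 := by
    ext k; fin_cases k <;> simp
  rw [hy, map_add, map_smul, map_smul] at h2
  simp at h2
  rw [← h2]; ring

theorem Matrix.rank_le_two_of_eq_add {α β : Type*} [Fintype α] [Fintype β]
    {M : Matrix α β ℝ} {u u' : α → ℝ} {v v' : β → ℝ}
    (h : ∀ a b, M a b = u a * v b + u' a * v' b) : M.rank ≤ 2 := by
  have hM : M = Matrix.of (fun a => ![u a, u' a]) * Matrix.of ![v, v'] := by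
    ext a b
    simp [Matrix.mul_apply, h]
  rw [hM]
  exact (Matrix.rank_mul_le_left _ _).trans
    ((Matrix.rank_le_card_width _).trans_eq (Fintype.card_fin 2))

theorem Matrix.isClosed_setOf_rank_le {α β : Type*} [Fintype α] [Fintype β] (k : ℕ) :
    IsClosed {M : Matrix α β ℝ | M.rank ≤ k} := by
  classical
  have hcont : Continuous fun M : Matrix α β ℝ => M.mulVecLin.toContinuousLinearMap :=
    (LinearMap.toContinuousLinearMap.toLinearMap ∘ₗ
      (Matrix.mulVecBilin ℝ ℝ : Matrix α β ℝ →ₗ[ℝ] _)).continuous_of_finiteDimensional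
  have hopen := (isOpen_setOfPred_nat_le_rank (𝕜 := ℝ)
    (E := β → ℝ) (F := α → ℝ) (k + 1)).preimage hcont
  rw [← isOpen_compl_iff]
  convert hopen using 1
  ext M
  simp [Matrix.rank, LinearMap.rank, ← Module.finrank_eq_rank]
  norm_cast

theorem Det222_rankTwo_nonneg (x x' y y' z z' : Fin 2 → ℝ) :
    0 ≤ Det222 fun p q r => x p * y q * z r + x' p * y' q * z' r := by
  have h : Det222 (fun p q r => x p * y q * z r + x' p * y' q * z' r) =
      ((x 0 * x' 1 - x 1 * x' 0) * (y 0 * y' 1 - y 1 * y' 0) * (z 0 * z' 1 - z 1 * z' 0)) ^ 2 := by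
    simp only [Det222]; ring
  rw [h]; positivity

theorem Finset.prod_update_three {ι M : Type*} [Fintype ι] [DecidableEq ι] [CommMonoid M]
    {κ : ι → Type*} (a : ∀ i, κ i → M) {i₁ i₂ i₃ : ι} (h₁₂ : i₁ ≠ i₂) (h₁₃ : i₁ ≠ i₃)
    (h₂₃ : i₂ ≠ i₃) (j : ∀ i, κ i) (p : κ i₁) (q : κ i₂) (r : κ i₃) :
    ∏ i, a i (Function.update (Function.update (Function.update j i₁ p) i₂ q) i₃ r i) =
      a i₁ p * a i₂ q * a i₃ r * ∏ i ∈ ({i₁, i₂, i₃} : Finset ι)ᶜ, a i (j i) := by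
  rw [← Finset.prod_mul_prod_compl {i₁, i₂, i₃}]
  congr 1
  · rw [Finset.prod_insert (by simp [h₁₂, h₁₃]), Finset.prod_pair h₂₃]
    simp [h₁₂, h₁₃, h₂₃, mul_assoc]
  · refine Finset.prod_congr rfl fun i hi => ?_
    simp only [Finset.mem_compl, Finset.mem_insert, Finset.mem_singleton, not_or] at hi
    simp [hi.1, hi.2.1, hi.2.2]

/-- The tensor `T` is a sum of two pure tensors. -/
def IsRankLeTwo {ι : Type*} [Fintype ι] {κ : ι → Type*} (T : (∀ i, κ i) → ℝ) : Prop :=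
  ∃ a b : ∀ i, κ i → ℝ, ∀ j, T j = (∏ i, a i (j i)) + ∏ i, b i (j i)

theorem IsRankLeTwo.rank_flattening_le {d : ℕ} {n : Fin d → ℕ} {T : (∀ i, Fin (n i)) → ℝ}
    (hT : IsRankLeTwo T) (S : Finset (Fin d)) : (flattening T S).rank ≤ 2 := by
  obtain ⟨a, b, hab⟩ := hT
  have hprod : ∀ (c : ∀ i, Fin (n i) → ℝ) (r : ∀ i : {i // i ∈ S}, Fin (n i))
      (s : ∀ i : {i // i ∉ S}, Fin (n i)),
      (∏ i, c i ((if h : i ∈ S then r ⟨i, h⟩ else s ⟨i, h⟩ : Fin (n i)))) =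
      (∏ i : {i // i ∈ S}, c i (r i)) * ∏ i : {i // i ∉ S}, c i (s i) := by
    intro c r s
    rw [← Fintype.prod_subtype_mul_prod_subtype (· ∈ S)]
    congr 1
    · exact Finset.prod_congr (by ext; simp) fun i _ => by rw [dif_pos i.2]
    · exact Finset.prod_congr rfl fun i _ => by rw [dif_neg i.2]
  refine Matrix.rank_le_two_of_eq_add
    (u := fun r => ∏ i : {i // i ∈ S}, a i (r i)) (v := fun s => ∏ i : {i // i ∉ S}, a i (s i))
    (u' := fun r => ∏ i : {i // i ∈ S}, b i (r i)) (v' := fun s => ∏ i : {i // i ∉ S}, b i (s i))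
    fun r s => ?_
  simp only [flattening, hab, hprod]

theorem IsRankLeTwo.det222_nonneg {d : ℕ} {n : Fin d → ℕ} {T : (∀ i, Fin (n i)) → ℝ}
    (hT : IsRankLeTwo T) {i₁ i₂ i₃ : Fin d} (h₁₂ : i₁ ≠ i₂) (h₁₃ : i₁ ≠ i₃) (h₂₃ : i₂ ≠ i₃)
    (u : Fin 2 → Fin (n i₁)) (v : Fin 2 → Fin (n i₂)) (w : Fin 2 → Fin (n i₃))
    (j₀ : ∀ i, Fin (n i)) : 0 ≤ Det222 (subTensor222 T i₁ i₂ i₃ u v w j₀) := by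
  obtain ⟨a, b, hab⟩ := hT
  convert Det222_rankTwo_nonneg
    (fun p => a i₁ (u p) * ∏ i ∈ ({i₁, i₂, i₃} : Finset (Fin d))ᶜ, a i (j₀ i))
    (fun p => b i₁ (u p) * ∏ i ∈ ({i₁, i₂, i₃} : Finset (Fin d))ᶜ, b i (j₀ i))
    (fun q => a i₂ (v q)) (fun q => b i₂ (v q)) (fun r => a i₃ (w r)) (fun r => b i₃ (w r)) using 2
  ext p q r
  simp only [subTensor222, hab, Finset.prod_update_three _ h₁₂ h₁₃ h₂₃]
  ring

theorem isClosed_setOf_rank_flattening_le {d : ℕ} {n : Fin d → ℕ} (S : Finset (Fin d)) :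
    IsClosed {T : (∀ i, Fin (n i)) → ℝ | (flattening T S).rank ≤ 2} :=
  (Matrix.isClosed_setOf_rank_le 2).preimage (f := fun T => flattening T S)
    (continuous_pi fun r => continuous_pi fun c =>
      continuous_apply (fun i => if h : i ∈ S then r ⟨i, h⟩ else c ⟨i, h⟩ : ∀ i, Fin (n i)))

theorem isClosed_setOf_det222_nonneg {d : ℕ} {n : Fin d → ℕ} (i₁ i₂ i₃ : Fin d)
    (u : Fin 2 → Fin (n i₁)) (v : Fin 2 → Fin (n i₂)) (w : Fin 2 → Fin (n i₃))
    (j₀ : ∀ i, Fin (n i)) :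
    IsClosed {T : (∀ i, Fin (n i)) → ℝ | 0 ≤ Det222 (subTensor222 T i₁ i₂ i₃ u v w j₀)} := by
  refine isClosed_Ici.preimage (f := fun T => Det222 (subTensor222 T i₁ i₂ i₃ u v w j₀)) ?_
  simp only [Det222, subTensor222]
  fun_prop
theorem exists_det_linearCombination_ne_zero {B C : Matrix (Fin 2) (Fin 2) ℝ}
    (hl : ∀ c₀ c₁ : ℝ, (∀ b, c₀ * B 0 b + c₁ * B 1 b = 0) → (∀ b, c₀ * C 0 b + c₁ * C 1 b = 0) →
      c₀ = 0 ∧ c₁ = 0)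
    (hr : ∀ c₀ c₁ : ℝ, (∀ a, c₀ * B a 0 + c₁ * B a 1 = 0) → (∀ a, c₀ * C a 0 + c₁ * C a 1 = 0) →
      c₀ = 0 ∧ c₁ = 0) :
    ∃ s t : ℝ, (s • B + t • C).det ≠ 0 := by
  by_contra! h
  have h1 := h 1 0
  have h2 := h 0 1
  have h3 := h 1 1
  simp only [Matrix.det_fin_two, Matrix.add_apply, Matrix.smul_apply, smul_eq_mul] at h1 h2 h3
  simp only [Fin.forall_fin_two] at hl hr
  generalize B 0 0 = b₀ at *
  generalize B 0 1 = b₁ at *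
  generalize B 1 0 = b₂ at *
  generalize B 1 1 = b₃ at *
  generalize C 0 0 = d₀ at *
  generalize C 0 1 = d₁ at *
  generalize C 1 0 = d₂ at *
  generalize C 1 1 = d₃ at *
  have hb : b₀ * b₃ - b₁ * b₂ = 0 := by linear_combination h1
  have hd : d₀ * d₃ - d₁ * d₂ = 0 := by linear_combination h2
  have hp : b₀ * d₃ + b₃ * d₀ - b₁ * d₂ - b₂ * d₁ = 0 := by linear_combination h3 - h1 - h2
  have hrow : ¬ (b₀ * d₂ - b₂ * d₀ = 0 ∧ b₀ * d₃ - b₂ * d₁ = 0 ∧ b₁ * d₂ - b₃ * d₀ = 0 ∧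
      b₁ * d₃ - b₃ * d₁ = 0) := by
    rintro ⟨e1, e2, e3, e4⟩
    have k0 := hl b₂ (-b₀) (by constructor <;> grind) (by constructor <;> grind)
    have k1 := hl b₃ (-b₁) (by constructor <;> grind) (by constructor <;> grind)
    have k2 := hl d₂ (-d₀) (by constructor <;> grind) (by constructor <;> grind)
    have k3 := hl d₃ (-d₁) (by constructor <;> grind) (by constructor <;> grind)
    have k4 := hl 1 0 (by constructor <;> grind) (by constructor <;> grind)
    grind
  have hcol : ¬ (b₀ * d₁ - b₁ * d₀ = 0 ∧ b₀ * d₃ - b₁ * d₂ = 0 ∧ b₂ * d₁ - b₃ * d₀ = 0 ∧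
      b₂ * d₃ - b₃ * d₂ = 0) := by
    rintro ⟨e1, e2, e3, e4⟩
    have k0 := hr b₁ (-b₀) (by constructor <;> grind) (by constructor <;> grind)
    have k1 := hr b₃ (-b₂) (by constructor <;> grind) (by constructor <;> grind)
    have k2 := hr d₁ (-d₀) (by constructor <;> grind) (by constructor <;> grind)
    have k3 := hr d₃ (-d₂) (by constructor <;> grind) (by constructor <;> grind)
    have k4 := hr 1 0 (by constructor <;> grind) (by constructor <;> grind)
    grind
  refine hrow ⟨?_, ?_, ?_, ?_⟩ <;> by_contra hne <;> refine hcol ⟨?_, ?_, ?_, ?_⟩ <;>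
    refine (mul_eq_zero.1 ?_).resolve_left hne <;> grind

theorem exists_det_vec_mulVec_ne_zero {m n k : ℝ} (h : ¬ (m = 0 ∧ n = 0 ∧ k = 0)) :
    ∃ x y : ℝ, x * (k * x - m * y) - y * (m * x + n * y) ≠ 0 := by
  by_contra! h'
  have h1 := h' 1 0
  have h2 := h' 0 1
  have h3 := h' 1 1
  exact h ⟨by linarith, by linarith, by linarith⟩

/-- The two real normal forms of a pencil of symmetric `2 × 2` matrices. -/
def IsPencilNormalForm (P : Set (Matrix (Fin 2) (Fin 2) ℝ)) : Prop :=
  (∀ M ∈ P, M 0 1 = 0 ∧ M 1 0 = 0) ∨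
    ∃ δ : ℝ, δ ≤ 0 ∧ ∀ M ∈ P, M 1 0 = M 0 1 ∧ M 1 1 = δ * M 0 0

theorem exists_normalForm_of_trace_eq_zero (M : Matrix (Fin 2) (Fin 2) ℝ) (hM : M.trace = 0) :
    ∃ P Q : Matrix (Fin 2) (Fin 2) ℝ, P.det ≠ 0 ∧ Q.det ≠ 0 ∧
      IsPencilNormalForm {P * Q, P * M * Q} := by
  obtain ⟨m, n, k, rfl⟩ : ∃ m n k : ℝ, M = !![m, n; k, -m] := by
    refine ⟨M 0 0, M 0 1, M 1 0, ?_⟩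
    rw [Matrix.trace_fin_two] at hM
    ext a b
    fin_cases a <;> fin_cases b <;> simp
    linarith
  by_cases h0 : m = 0 ∧ n = 0 ∧ k = 0
  · refine ⟨1, 1, by simp, by simp, Or.inl ?_⟩
    obtain ⟨rfl, rfl, rfl⟩ := h0
    simp
  obtain ⟨x, y, hxy⟩ := exists_det_vec_mulVec_ne_zero h0
  rcases le_or_gt (m ^ 2 + n * k) 0 with hδ | hδ
  · refine ⟨!![-y, x; k * x - m * y, -(m * x + n * y)], !![x, m * x + n * y; y, k * x - m * y],
      ?_, ?_, Or.inr ⟨m ^ 2 + n * k, hδ, ?_⟩⟩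
    · rw [Matrix.det_fin_two_of]; intro h; apply hxy; linear_combination -h
    · rw [Matrix.det_fin_two_of]; intro h; apply hxy; linear_combination h
    · simp
      refine ⟨⟨?_, ?_⟩, ?_, ?_⟩ <;> ring
  · obtain ⟨w, hw, hw2⟩ : ∃ w : ℝ, 0 < w ∧ w ^ 2 = m ^ 2 + n * k :=
      ⟨√(m ^ 2 + n * k), Real.sqrt_pos.2 hδ, Real.sq_sqrt hδ.le⟩
    have hV : (!![w, w; 1, -1] : Matrix (Fin 2) (Fin 2) ℝ).det ≠ 0 := by
      rw [Matrix.det_fin_two_of]; intro h; apply hw.ne'; linarith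
    refine ⟨!![w, 1; w, -1] * !![-y, x; k * x - m * y, -(m * x + n * y)],
      !![x, m * x + n * y; y, k * x - m * y] * !![w, w; 1, -1], ?_, ?_, Or.inl ?_⟩
    · rw [Matrix.det_mul]
      refine mul_ne_zero ?_ ?_
      · rw [Matrix.det_fin_two_of]; intro h; apply hw.ne'; linarith
      rw [Matrix.det_fin_two_of]; intro h; apply hxy; linear_combination -h
    · rw [Matrix.det_mul]
      refine mul_ne_zero ?_ hV
      rw [Matrix.det_fin_two_of]; intro h; apply hxy; linear_combination h
    · simp
      refine ⟨⟨?_, ?_⟩, ?_, ?_⟩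
      · ring
      · ring
      · linear_combination (k * x * x - 2 * m * x * y - n * y * y) * hw2
      · linear_combination (k * x * x - 2 * m * x * y - n * y * y) * hw2

theorem IsPencilNormalForm.linearCombination {A C : Matrix (Fin 2) (Fin 2) ℝ}
    (h : IsPencilNormalForm {A, C}) :
    IsPencilNormalForm {M | ∃ s t : ℝ, M = s • A + t • C} := by
  rcases h with h | ⟨δ, hδ, h⟩
  · left
    rintro _ ⟨s, t, rfl⟩
    have hA := h A (by simp)
    have hC := h C (by simp)
    simp [hA, hC]
  · right
    refine ⟨δ, hδ, ?_⟩
    rintro _ ⟨s, t, rfl⟩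
    have hA := h A (by simp)
    have hC := h C (by simp)
    simp only [Matrix.add_apply, Matrix.smul_apply, smul_eq_mul, hA.1, hA.2, hC.1, hC.2, true_and]
    ring

theorem IsPencilNormalForm.mono {P Q : Set (Matrix (Fin 2) (Fin 2) ℝ)} (h : IsPencilNormalForm Q)
    (hPQ : P ⊆ Q) : IsPencilNormalForm P :=
  h.imp (fun h M hM => h M (hPQ hM)) fun ⟨δ, hδ, h⟩ => ⟨δ, hδ, fun M hM => h M (hPQ hM)⟩

/-- Real normal form of a pencil of `2 × 2` matrices without common kernels. -/
theorem exists_pencilNormalForm {B C : Matrix (Fin 2) (Fin 2) ℝ}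
    (hl : ∀ c₀ c₁ : ℝ, (∀ b, c₀ * B 0 b + c₁ * B 1 b = 0) → (∀ b, c₀ * C 0 b + c₁ * C 1 b = 0) →
      c₀ = 0 ∧ c₁ = 0)
    (hr : ∀ c₀ c₁ : ℝ, (∀ a, c₀ * B a 0 + c₁ * B a 1 = 0) → (∀ a, c₀ * C a 0 + c₁ * C a 1 = 0) →
      c₀ = 0 ∧ c₁ = 0) :
    ∃ P Q : Matrix (Fin 2) (Fin 2) ℝ, P.det ≠ 0 ∧ Q.det ≠ 0 ∧
      IsPencilNormalForm {M | ∃ s t : ℝ, M = P * (s • B + t • C) * Q} := by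
  obtain ⟨s, t, hst⟩ := exists_det_linearCombination_ne_zero hl hr
  obtain ⟨D, hD⟩ : ∃ D, ∀ s' t' : ℝ, ∃ s'' t'' : ℝ,
      s' • B + t' • C = s'' • (s • B + t • C) + t'' • D := by
    by_cases hs : s = 0
    · subst hs
      have ht : t ≠ 0 := by rintro rfl; simp at hst
      refine ⟨B, fun s' t' => ⟨t' / t, s', ?_⟩⟩
      rw [zero_smul, zero_add, smul_smul, div_mul_cancel₀ _ ht, add_comm]
    · refine ⟨C, fun s' t' => ⟨s' / s, t' - s' / s * t, ?_⟩⟩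
      rw [smul_add, smul_smul, smul_smul, div_mul_cancel₀ _ hs, sub_smul]
      abel
  set A := s • B + t • C with hA
  have hu : IsUnit A.det := hst.isUnit
  set M := A⁻¹ * D - ((A⁻¹ * D).trace / 2) • (1 : Matrix (Fin 2) (Fin 2) ℝ) with hMdef
  have hM : M.trace = 0 := by
    simp [hMdef, Matrix.trace_sub, Matrix.trace_smul]
  obtain ⟨P, Q, hP, hQ, h⟩ := exists_normalForm_of_trace_eq_zero M hM
  refine ⟨P * A⁻¹, Q, ?_, hQ, h.linearCombination.mono ?_⟩
  · rw [Matrix.det_mul]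
    exact mul_ne_zero hP ((Matrix.isUnit_nonsing_inv_det A hu).ne_zero)
  · rintro _ ⟨s', t', rfl⟩
    obtain ⟨s'', t'', h''⟩ := hD s' t'
    refine ⟨s'' + t'' * ((A⁻¹ * D).trace / 2), t'', ?_⟩
    rw [h'', hMdef]
    have h1 : A⁻¹ * A = 1 := Matrix.nonsing_inv_mul A hu
    simp only [Matrix.mul_add, Matrix.add_mul, Matrix.mul_sub, Matrix.sub_mul, Matrix.mul_smul,
      Matrix.smul_mul, Matrix.mul_assoc, smul_sub, add_smul, Matrix.mul_one]
    rw [← Matrix.mul_assoc A⁻¹ A Q, h1, Matrix.one_mul, smul_smul]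
    abel

section Tensor

variable {ι : Type*} [DecidableEq ι] {κ : ι → Type*}

/-- All `2 × 2` minors of the flattening of `T` at the single axis `k` vanish. -/
def MinorsVanishAt (T : (∀ i, κ i) → ℝ) (k : ι) : Prop :=
  ∀ r s, T r * T s = T (Function.update r k (s k)) * T (Function.update s k (r k))

/-- The flattening of `T` at `S` is a sum of two products. -/
def FlatteningFactors (T : (∀ i, κ i) → ℝ) (S : Finset ι) : Prop :=
  ∃ U V : Fin 2 → (∀ i, κ i) → ℝ,
    ∀ r c, T (S.piecewise r c) = U 0 r * V 0 c + U 1 r * V 1 c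

theorem eq_mul_prod_of_minors_eq_zero {R : Type*} [CommRing R] {Z : (∀ i, κ i) → R}
    {r₀ : ∀ i, κ i} (hu : IsUnit (Z r₀)) (F : Finset ι)
    (hF : ∀ k ∈ F, ∀ r, Z r * Z r₀ =
      Z (Function.update r k (r₀ k)) * Z (Function.update r₀ k (r k))) (r : ∀ i, κ i) :
    Z r = Z (F.piecewise r₀ r) *
      ∏ k ∈ F, (Ring.inverse (Z r₀) * Z (Function.update r₀ k (r k))) := by
  induction F using Finset.induction_on with
  | empty => simp
  | insert k F hk ih =>
    rw [ih fun l hl => hF l (Finset.mem_insert_of_mem hl), Finset.prod_insert hk,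
      Finset.piecewise_insert]
    have h := hF k (Finset.mem_insert_self k F) (F.piecewise r₀ r)
    rw [Finset.piecewise_eq_of_notMem _ _ _ hk] at h
    have h1 := Ring.mul_inverse_cancel _ hu
    linear_combination Ring.inverse (Z r₀) *
      (∏ k ∈ F, (Ring.inverse (Z r₀) * Z (Function.update r₀ k (r k)))) * h -
      Z (F.piecewise r₀ r) *
      (∏ k ∈ F, (Ring.inverse (Z r₀) * Z (Function.update r₀ k (r k)))) * h1

theorem exists_prod_eq_mul_prod_compl [Fintype ι] {R : Type*} [CommMonoid R] {i j : ι}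
    (hij : i ≠ j) (f : κ i → R) (g : κ j → R) (z : ∀ k, κ k → R) :
    ∃ a : ∀ k, κ k → R, ∀ r : ∀ k, κ k,
      ∏ k, a k (r k) = f (r i) * g (r j) * ∏ k ∈ ({i, j} : Finset ι)ᶜ, z k (r k) := by
  refine ⟨Function.update (Function.update z i f) j g, fun r => ?_⟩
  rw [← Finset.prod_mul_prod_compl {i, j}, Finset.prod_pair hij]
  congr 1
  · simp [hij]
  · refine Finset.prod_congr rfl fun k hk => ?_
    simp only [Finset.mem_compl, Finset.mem_insert, Finset.mem_singleton, not_or] at hk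
    simp [hk.1, hk.2]

theorem isRankLeTwo_of_minorsVanishAt [Fintype ι] {T : (∀ i, κ i) → ℝ} {i j : ι} (hij : i ≠ j)
    (hT : FlatteningFactors T {i}) (hk : ∀ k, k ≠ i → k ≠ j → MinorsVanishAt T k)
    {r₀ : ∀ i, κ i} (hr₀ : T r₀ ≠ 0) : IsRankLeTwo T := by
  obtain ⟨U, V, hUV⟩ := hT
  have hpure := eq_mul_prod_of_minors_eq_zero (hr₀.isUnit) ({i, j} : Finset ι)ᶜ
    fun k hk' => by
      simp only [Finset.mem_compl, Finset.mem_insert, Finset.mem_singleton, not_or] at hk'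
      exact fun r => hk k hk'.1 hk'.2 r r₀
  have hp : ∀ r : ∀ i, κ i, (({i, j} : Finset ι)ᶜ).piecewise r₀ r =
      ({i} : Finset ι).piecewise (Function.update r₀ i (r i)) (Function.update r₀ j (r j)) := by
    intro r
    ext l
    by_cases hli : l = i
    · subst hli; simp
    · by_cases hlj : l = j
      · subst hlj; simp [Finset.piecewise, hij.symm]
      · simp [Finset.piecewise, hli, hlj]
  obtain ⟨a, ha⟩ := exists_prod_eq_mul_prod_compl hij
    (fun x => U 0 (Function.update r₀ i x)) (fun y => V 0 (Function.update r₀ j y))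
    (fun k x => Ring.inverse (T r₀) * T (Function.update r₀ k x))
  obtain ⟨b, hb⟩ := exists_prod_eq_mul_prod_compl hij
    (fun x => U 1 (Function.update r₀ i x)) (fun y => V 1 (Function.update r₀ j y))
    (fun k x => Ring.inverse (T r₀) * T (Function.update r₀ k x))
  refine ⟨a, b, fun r => ?_⟩
  rw [ha, hb, hpure r, hp, hUV]
  ring

/-- An axis of rank two has two slices that form a basis of the space of slices. -/
theorem exists_basis_slices {T : (∀ i, κ i) → ℝ} {i : ι} (hT : FlatteningFactors T {i})
    (hi : ¬ MinorsVanishAt T i) :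
    ∃ (p : Fin 2 → κ i) (x : κ i → Fin 2 → ℝ),
      (∀ r, T r = x (r i) 0 * T (Function.update r i (p 0)) +
        x (r i) 1 * T (Function.update r i (p 1))) ∧
      ∀ c₀ c₁ : ℝ, (∀ r, c₀ * T (Function.update r i (p 0)) +
        c₁ * T (Function.update r i (p 1)) = 0) → c₀ = 0 ∧ c₁ = 0 := by
  obtain ⟨U, V, hUV⟩ := hT
  simp only [MinorsVanishAt, not_forall] at hi
  obtain ⟨r, s, hrs⟩ := hi
  have hpw : ∀ (c : ∀ i, κ i) (y : κ i), T (Function.update c i y) =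
      U 0 (Function.update r i y) * V 0 c + U 1 (Function.update r i y) * V 1 c := by
    intro c y
    rw [← hUV]
    congr 1
    ext l
    by_cases hl : l = i
    · subst hl; simp
    · simp [hl]
  have hself : ∀ c : ∀ i, κ i, T c =
      U 0 (Function.update r i (c i)) * V 0 c + U 1 (Function.update r i (c i)) * V 1 c := by
    intro c
    conv_lhs => rw [← Function.update_eq_self i c]
    exact hpw c (c i)
  rw [hpw, hpw, hself r, hself s] at hrs
  have hD : (U 0 (Function.update r i (r i)) * U 1 (Function.update r i (s i)) -
      U 1 (Function.update r i (r i)) * U 0 (Function.update r i (s i))) *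
      (V 0 r * V 1 s - V 1 r * V 0 s) ≠ 0 := by
    intro h
    apply hrs
    linear_combination h
  obtain ⟨hDU, hDV⟩ := mul_ne_zero_iff.1 hD
  generalize hu₀ : Function.update r i (r i) = u₀ at *
  generalize hu₁ : Function.update r i (s i) = u₁ at *
  refine ⟨![r i, s i], fun y =>
    ![(U 0 (Function.update r i y) * U 1 u₁ - U 1 (Function.update r i y) * U 0 u₁) /
        (U 0 u₀ * U 1 u₁ - U 1 u₀ * U 0 u₁),
      (U 0 u₀ * U 1 (Function.update r i y) - U 1 u₀ * U 0 (Function.update r i y)) /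
        (U 0 u₀ * U 1 u₁ - U 1 u₀ * U 0 u₁)], fun c => ?_, fun c₀ c₁ h => ?_⟩
  · simp only [Matrix.cons_val_zero, Matrix.cons_val_one, hpw, hu₀, hu₁]
    rw [hself c, div_mul_eq_mul_div, div_mul_eq_mul_div, ← add_div, eq_div_iff hDU]
    ring
  · simp only [Matrix.cons_val_zero, Matrix.cons_val_one, hpw, hu₀, hu₁] at h
    have hr := h r
    have hs := h s
    constructor
    · refine (mul_eq_zero.1 (?_ : c₀ * _ = 0)).resolve_right hD
      linear_combination (U 0 u₁ * V 0 s + U 1 u₁ * V 1 s) * hr -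
        (U 0 u₁ * V 0 r + U 1 u₁ * V 1 r) * hs
    · refine (mul_eq_zero.1 (?_ : c₁ * _ = 0)).resolve_right hD
      linear_combination (U 0 u₀ * V 0 r + U 1 u₀ * V 1 r) * hs -
        (U 0 u₀ * V 0 s + U 1 u₀ * V 1 s) * hr

/-- The `2 × 2` matrix of entries of `T` at the indices `p` along axis `i` and `q` along
axis `j`. -/
def sliceMatrix (T : (∀ i, κ i) → ℝ) {i j : ι} (p : Fin 2 → κ i) (q : Fin 2 → κ j)
    (r : ∀ i, κ i) : Matrix (Fin 2) (Fin 2) ℝ :=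
  Matrix.of fun a b => T (Function.update (Function.update r i (p a)) j (q b))

theorem det_sliceMatrix_eq_zero {T : (∀ i, κ i) → ℝ} {i j k : ι} (hij : i ≠ j) (hki : k ≠ i)
    (hkj : k ≠ j) (hT : FlatteningFactors T {i, k}) (p : Fin 2 → κ i) (q : Fin 2 → κ j)
    (A B : Matrix (Fin 2) (Fin 2) ℝ) {W : (∀ i, κ i) → Matrix (Fin 2) (Fin 2) ℝ}
    (hW : ∀ r, W r = A * sliceMatrix T p q r * B) (a₀ a₁ a₂ b₀ b₁ b₂ : Fin 2)
    (r₀ r₁ r₂ c₀ c₁ c₂ : ∀ i, κ i) :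
    W (Function.update c₀ k (r₀ k)) a₀ b₀ * (W (Function.update c₁ k (r₁ k)) a₁ b₁ *
        W (Function.update c₂ k (r₂ k)) a₂ b₂ - W (Function.update c₂ k (r₁ k)) a₁ b₂ *
        W (Function.update c₁ k (r₂ k)) a₂ b₁) -
      W (Function.update c₁ k (r₀ k)) a₀ b₁ * (W (Function.update c₀ k (r₁ k)) a₁ b₀ *
        W (Function.update c₂ k (r₂ k)) a₂ b₂ - W (Function.update c₂ k (r₁ k)) a₁ b₂ *
        W (Function.update c₀ k (r₂ k)) a₂ b₀) +
      W (Function.update c₂ k (r₀ k)) a₀ b₂ * (W (Function.update c₀ k (r₁ k)) a₁ b₀ *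
        W (Function.update c₁ k (r₂ k)) a₂ b₁ - W (Function.update c₁ k (r₁ k)) a₁ b₁ *
        W (Function.update c₀ k (r₂ k)) a₂ b₀) = 0 := by
  obtain ⟨U, V, hUV⟩ := hT
  have hpw : ∀ (r c : ∀ i, κ i) (y : κ i) (z : κ j),
      T (Function.update (Function.update (Function.update c k (r k)) i y) j z) =
      U 0 (Function.update r i y) * V 0 (Function.update c j z) +
      U 1 (Function.update r i y) * V 1 (Function.update c j z) := by
    intro r c y z
    rw [← hUV]
    congr 1
    ext l
    by_cases hli : l = i
    · subst hli; simp [Finset.piecewise, hij]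
    · by_cases hlj : l = j
      · subst hlj; simp [Finset.piecewise, hli, hkj.symm]
      · by_cases hlk : l = k
        · subst hlk; simp [Finset.piecewise, hli, hlj]
        · simp [Finset.piecewise, hli, hlj, hlk]
  have hentry : ∀ (a b : Fin 2) (r c : ∀ i, κ i), W (Function.update c k (r k)) a b =
      (∑ a', A a a' * U 0 (Function.update r i (p a'))) *
        (∑ b', V 0 (Function.update c j (q b')) * B b' b) +
      (∑ a', A a a' * U 1 (Function.update r i (p a'))) *
        (∑ b', V 1 (Function.update c j (q b')) * B b' b) := by
    intro a b r c
    simp only [hW, Matrix.mul_apply, sliceMatrix, Matrix.of_apply, hpw, Fin.sum_univ_two]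
    ring
  simp only [hentry]
  ring

theorem exists_sliceMatrix_normalForm [Fintype ι] {T : (∀ i, κ i) → ℝ}
    (hT : ∀ S : Finset ι, S.Nonempty → S ≠ Finset.univ → FlatteningFactors T S)
    {i j k : ι} (hij : i ≠ j) (hki : k ≠ i) (hkj : k ≠ j)
    (hi : ¬ MinorsVanishAt T i) (hj : ¬ MinorsVanishAt T j) :
    ∃ (p : Fin 2 → κ i) (q : Fin 2 → κ j) (P Q : Matrix (Fin 2) (Fin 2) ℝ)
      (x : κ i → Fin 2 → ℝ) (y : κ j → Fin 2 → ℝ),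
      (∀ r, T r = ∑ a, ∑ b, x (r i) a * y (r j) b * (P * sliceMatrix T p q r * Q) a b) ∧
      IsPencilNormalForm (Set.range fun r => P * sliceMatrix T p q r * Q) := by
  have hsing : ∀ l, ∀ l' ≠ l, FlatteningFactors T {l} := fun l l' hl =>
    hT _ (Finset.singleton_nonempty l) fun h => hl (by simpa using h.symm.subset (Finset.mem_univ l'))
  obtain ⟨p, x, hx, hp⟩ := exists_basis_slices (hsing i j hij.symm) hi
  obtain ⟨q, y, hy, hq⟩ := exists_basis_slices (hsing j i hij) hj
  obtain ⟨U, V, hUV⟩ := hT {i, j} (by simp) fun h => by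
    have := h.symm.subset (Finset.mem_univ k)
    simp [hki, hkj] at this
  obtain ⟨r₀⟩ : Nonempty (∀ i, κ i) := by
    simp only [MinorsVanishAt, not_forall] at hi
    exact ⟨hi.choose⟩
  set B : Matrix (Fin 2) (Fin 2) ℝ := Matrix.of fun a b =>
    U 0 (Function.update (Function.update r₀ i (p a)) j (q b)) with hB
  set C : Matrix (Fin 2) (Fin 2) ℝ := Matrix.of fun a b =>
    U 1 (Function.update (Function.update r₀ i (p a)) j (q b)) with hC
  have hS : ∀ r, sliceMatrix T p q r = V 0 r • B + V 1 r • C := by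
    intro r
    ext a b
    have h := hUV (Function.update (Function.update r₀ i (p a)) j (q b)) r
    simp only [sliceMatrix, Matrix.of_apply, Matrix.add_apply, Matrix.smul_apply, smul_eq_mul,
      hB, hC]
    rw [mul_comm (V 0 r), mul_comm (V 1 r), ← h]
    congr 1
    ext l
    by_cases hli : l = i
    · subst hli; simp [Finset.piecewise, hij]
    · by_cases hlj : l = j
      · subst hlj; simp [Finset.piecewise]
      · simp [Finset.piecewise, hli, hlj]
  have hxi : ∀ r a, T (Function.update r i (p a)) =
      y (r j) 0 * sliceMatrix T p q r a 0 + y (r j) 1 * sliceMatrix T p q r a 1 := by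
    intro r a
    rw [hy (Function.update r i (p a)), Function.update_of_ne hij.symm]
    rfl
  have hyj : ∀ r b, T (Function.update r j (q b)) =
      x (r i) 0 * sliceMatrix T p q r 0 b + x (r i) 1 * sliceMatrix T p q r 1 b := by
    intro r b
    rw [hx (Function.update r j (q b)), Function.update_of_ne hij,
      Function.update_comm hij.symm, Function.update_comm hij.symm]
    rfl
  obtain ⟨P, Q, hP, hQ, hPQ⟩ := exists_pencilNormalForm (B := B) (C := C)
    (fun c₀ c₁ h₁ h₂ => hp c₀ c₁ fun r => by
      simp only [hxi, hS, Matrix.add_apply, Matrix.smul_apply, smul_eq_mul]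
      linear_combination y (r j) 0 * (V 0 r * h₁ 0 + V 1 r * h₂ 0) +
        y (r j) 1 * (V 0 r * h₁ 1 + V 1 r * h₂ 1))
    (fun c₀ c₁ h₁ h₂ => hq c₀ c₁ fun r => by
      simp only [hyj, hS, Matrix.add_apply, Matrix.smul_apply, smul_eq_mul]
      linear_combination x (r i) 0 * (V 0 r * h₁ 0 + V 1 r * h₂ 0) +
        x (r i) 1 * (V 0 r * h₁ 1 + V 1 r * h₂ 1))
  refine ⟨p, q, P, Q, fun z => Matrix.vecMul (x z) P⁻¹, fun z => Matrix.mulVec Q⁻¹ (y z),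
    fun r => ?_, hPQ.mono ?_⟩
  · have h1 : T r = x (r i) ⬝ᵥ (Matrix.mulVec (sliceMatrix T p q r) (y (r j))) := by
      rw [hx r, hxi, hxi]
      simp [dotProduct, Matrix.mulVec, Fin.sum_univ_two]
      ring
    have h2 : sliceMatrix T p q r = P⁻¹ * (P * sliceMatrix T p q r * Q) * Q⁻¹ := by
      rw [Matrix.mul_assoc P, Matrix.nonsing_inv_mul_cancel_left _ _ hP.isUnit,
        Matrix.mul_nonsing_inv_cancel_right _ _ hQ.isUnit]
    rw [h1]
    conv_lhs => rw [h2]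
    rw [← Matrix.mulVec_mulVec, ← Matrix.mulVec_mulVec, Matrix.dotProduct_mulVec]
    beta_reduce
    generalize Matrix.vecMul (x (r i)) P⁻¹ = u
    generalize Matrix.mulVec Q⁻¹ (y (r j)) = v
    simp only [dotProduct, Matrix.mulVec, Fin.sum_univ_two]
    ring
  · rintro _ ⟨r, rfl⟩
    exact ⟨V 0 r, V 1 r, by simp only [hS]⟩

theorem sliceMatrix_update_left (T : (∀ i, κ i) → ℝ) {i j : ι} (p : Fin 2 → κ i)
    (q : Fin 2 → κ j) (r : ∀ i, κ i) (z : κ i) :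
    sliceMatrix T p q (Function.update r i z) = sliceMatrix T p q r := by
  simp [sliceMatrix]

theorem sliceMatrix_piecewise [Fintype ι] (T : (∀ i, κ i) → ℝ) {i j : ι} (hij : i ≠ j)
    (p : Fin 2 → κ i) (q : Fin 2 → κ j) (r s : ∀ i, κ i) :
    sliceMatrix T p q ((({i, j} : Finset ι)ᶜ).piecewise r s) = sliceMatrix T p q r := by
  ext a b
  simp only [sliceMatrix, Matrix.of_apply]
  congr 1
  ext l
  by_cases hlj : l = j
  · subst hlj; simp
  · by_cases hli : l = i
    · subst hli; simp [hlj]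
    · simp [Finset.piecewise, hli, hlj]

theorem minorsVanishAt_of_eq_mul {T : (∀ i, κ i) → ℝ} {i : ι} {f : κ i → ℝ}
    {g : (∀ i, κ i) → ℝ} (hg : ∀ r z, g (Function.update r i z) = g r)
    (h : ∀ r, T r = f (r i) * g r) : MinorsVanishAt T i := by
  intro r s
  simp only [h, hg, Function.update_self]
  ring

theorem isRankLeTwo_of_diagonal [Fintype ι] {T : (∀ i, κ i) → ℝ}
    {i j : ι} (hij : i ≠ j) (hi : ¬ MinorsVanishAt T i)
    (hT : ∀ k, k ≠ i → k ≠ j → FlatteningFactors T {i, k}) {p : Fin 2 → κ i} {q : Fin 2 → κ j}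
    {P Q : Matrix (Fin 2) (Fin 2) ℝ} {x : κ i → Fin 2 → ℝ} {y : κ j → Fin 2 → ℝ}
    (hxy : ∀ r, T r = ∑ a, ∑ b, x (r i) a * y (r j) b * (P * sliceMatrix T p q r * Q) a b)
    (hW : ∀ r, (P * sliceMatrix T p q r * Q) 0 1 = 0 ∧ (P * sliceMatrix T p q r * Q) 1 0 = 0) :
    IsRankLeTwo T := by
  set W := fun r => P * sliceMatrix T p q r * Q with hWdef
  change ∀ r, W r 0 1 = 0 ∧ W r 1 0 = 0 at hW
  replace hxy : ∀ r, T r = x (r i) 0 * y (r j) 0 * W r 0 0 + x (r i) 1 * y (r j) 1 * W r 1 1 := by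
    intro r
    rw [hxy r]
    simp only [Fin.sum_univ_two]
    change _ * W r 0 0 + _ * W r 0 1 + (_ * W r 1 0 + _ * W r 1 1) = _
    rw [(hW r).1, (hW r).2]
    ring
  have hWi : ∀ r z, W (Function.update r i z) = W r := fun r z => by
    simp only [hWdef, sliceMatrix_update_left]
  have hyi : ∀ (r : ∀ i, κ i) z, Function.update r i z j = r j := fun r z =>
    Function.update_of_ne hij.symm _ _
  have hoff : ∀ a b : Fin 2, a ≠ b → ∀ r, W r a b = 0 := by
    intro a b hab r
    fin_cases a <;> fin_cases b <;> first | exact absurd rfl hab | exact (hW r).1 | exact (hW r).2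
  have hne : ∀ a, ∃ r, W r a a ≠ 0 := by
    intro a
    by_contra! h
    refine hi ?_
    fin_cases a
    · refine minorsVanishAt_of_eq_mul (f := fun z => x z 1) (g := fun r => y (r j) 1 * W r 1 1)
        (fun r z => by simp only [hWi, hyi]) fun r => ?_
      have h0 : W r 0 0 = 0 := h r
      rw [hxy, h0]; ring
    · refine minorsVanishAt_of_eq_mul (f := fun z => x z 0) (g := fun r => y (r j) 0 * W r 0 0)
        (fun r z => by simp only [hWi, hyi]) fun r => ?_
      have h0 : W r 1 1 = 0 := h r
      rw [hxy, h0]; ring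
  have hminors : ∀ a b : Fin 2, a ≠ b → ∀ k, k ≠ i → k ≠ j → ∀ r s, W r a a * W s a a =
      W (Function.update r k (s k)) a a * W (Function.update s k (r k)) a a := by
    intro a b hab k hki hkj r s
    obtain ⟨t, ht⟩ := hne b
    have h := det_sliceMatrix_eq_zero hij hki hkj (hT k hki hkj) p q P Q (W := W) (fun _ => rfl)
      a a b a a b r s t r s t
    simp only [Function.update_eq_self, hoff a b hab, hoff b a hab.symm, mul_zero,
      sub_zero, add_zero] at h
    have h' : (W r a a * W s a a -
        W (Function.update r k (s k)) a a * W (Function.update s k (r k)) a a) * W t b b = 0 := by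
      linear_combination h
    exact sub_eq_zero.1 ((mul_eq_zero.1 h').resolve_right ht)
  have hpure : ∀ a b : Fin 2, a ≠ b → ∃ c : ∀ k, κ k → ℝ, ∀ r,
      x (r i) a * y (r j) a * W r a a = ∏ k, c k (r k) := by
    intro a b hab
    obtain ⟨r₀, hr₀⟩ := hne a
    obtain ⟨c, hc⟩ := exists_prod_eq_mul_prod_compl hij (fun z => x z a)
      (fun z => y z a * W r₀ a a)
      (fun k z => Ring.inverse (W r₀ a a) * W (Function.update r₀ k z) a a)
    refine ⟨c, fun r => ?_⟩
    rw [hc, eq_mul_prod_of_minors_eq_zero (Z := fun r => W r a a) hr₀.isUnit ({i, j} : Finset ι)ᶜ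
      (fun k hk r => ?_) r]
    · have : W ((({i, j} : Finset ι)ᶜ).piecewise r₀ r) = W r₀ := by
        simp only [hWdef, sliceMatrix_piecewise T hij]
      rw [this]; ring
    · simp only [Finset.mem_compl, Finset.mem_insert, Finset.mem_singleton, not_or] at hk
      exact hminors a b hab k hk.1 hk.2 r r₀
  obtain ⟨a, ha⟩ := hpure 0 1 (by simp)
  obtain ⟨b, hb⟩ := hpure 1 0 (by simp)
  exact ⟨a, b, fun r => by rw [hxy, ha, hb]⟩

/-- The tensor `T` is the imaginary part of a pure tensor over `ℝ[ω]` with `ω² = δ`. -/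
def IsImPure [Fintype ι] (δ : ℝ) (T : (∀ i, κ i) → ℝ) : Prop :=
  ∃ a : ∀ i, κ i → QuadraticAlgebra ℝ δ 0, ∀ r, T r = (∏ i, a i (r i)).im

theorem isImPure_of_normalForm [Fintype ι] {T : (∀ i, κ i) → ℝ}
    {i j : ι} (hij : i ≠ j) (hi : ¬ MinorsVanishAt T i)
    (hT : ∀ k, k ≠ i → k ≠ j → FlatteningFactors T {i, k}) {p : Fin 2 → κ i} {q : Fin 2 → κ j}
    {P Q : Matrix (Fin 2) (Fin 2) ℝ} {x : κ i → Fin 2 → ℝ} {y : κ j → Fin 2 → ℝ}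
    (hxy : ∀ r, T r = ∑ a, ∑ b, x (r i) a * y (r j) b * (P * sliceMatrix T p q r * Q) a b)
    {δ : ℝ} (hδ : δ ≤ 0)
    (hW : ∀ r, (P * sliceMatrix T p q r * Q) 1 0 = (P * sliceMatrix T p q r * Q) 0 1 ∧
      (P * sliceMatrix T p q r * Q) 1 1 = δ * (P * sliceMatrix T p q r * Q) 0 0) :
    IsImPure δ T := by
  set W := fun r => P * sliceMatrix T p q r * Q with hWdef
  change ∀ r, W r 1 0 = W r 0 1 ∧ W r 1 1 = δ * W r 0 0 at hW
  replace hxy : ∀ r, T r = x (r i) 0 * y (r j) 0 * W r 0 0 +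
      (x (r i) 0 * y (r j) 1 + x (r i) 1 * y (r j) 0) * W r 0 1 +
      x (r i) 1 * y (r j) 1 * (δ * W r 0 0) := by
    intro r
    rw [hxy r]
    simp only [Fin.sum_univ_two]
    change _ * W r 0 0 + _ * W r 0 1 + (_ * W r 1 0 + _ * W r 1 1) = _
    rw [(hW r).1, (hW r).2]
    ring
  obtain ⟨r₀, hr₀⟩ : ∃ r, W r 0 1 ^ 2 - δ * W r 0 0 ^ 2 ≠ 0 := by
    by_contra! h
    refine hi (minorsVanishAt_of_eq_mul (f := fun z => x z 0) (g := fun r => y (r j) 0 * W r 0 0)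
      (fun r z => ?_) fun r => ?_)
    · simp only [hWdef, sliceMatrix_update_left, Function.update_of_ne hij.symm]
    · have hr := h r
      have h1 : 0 ≤ -δ * W r 0 0 ^ 2 := mul_nonneg (neg_nonneg.2 hδ) (sq_nonneg _)
      have h2 : W r 0 1 = 0 := pow_eq_zero_iff two_ne_zero |>.1
        (le_antisymm (by linarith) (sq_nonneg _))
      have h3 : δ * W r 0 0 = 0 := by
        rw [h2] at hr
        rcases mul_eq_zero.1 (by linarith : δ * W r 0 0 ^ 2 = 0) with h | h
        · rw [h, zero_mul]
        · rw [pow_eq_zero_iff two_ne_zero |>.1 h, mul_zero]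
      rw [hxy, h2, h3]; ring
  let Z : (∀ i, κ i) → QuadraticAlgebra ℝ δ 0 := fun r => ⟨W r 0 1, W r 0 0⟩
  have hu : IsUnit (Z r₀) := by
    rw [QuadraticAlgebra.isUnit_iff_norm_isUnit, QuadraticAlgebra.norm_def]
    refine IsUnit.mk0 _ ?_
    convert hr₀ using 1
    simp only [Z]
    ring
  have hminors : ∀ k, k ≠ i → k ≠ j → ∀ r, Z r * Z r₀ =
      Z (Function.update r k (r₀ k)) * Z (Function.update r₀ k (r k)) := by
    intro k hki hkj r
    have h := fun b => det_sliceMatrix_eq_zero hij hki hkj (hT k hki hkj) p q P Q (W := W)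
      (fun _ => rfl) 0 1 0 0 1 b r₀ r₀ r r₀ r₀ r
    have h0 := h 0
    have h1 := h 1
    simp only [Function.update_eq_self, fun r => (hW r).1, fun r => (hW r).2] at h0 h1
    ext
    · refine mul_left_cancel₀ hr₀ ?_
      simp only [Z, QuadraticAlgebra.re_mul]
      linear_combination (-W r₀ 0 1) * h1 - δ * W r₀ 0 0 * h0
    · refine mul_left_cancel₀ hr₀ ?_
      simp only [Z, QuadraticAlgebra.im_mul]
      linear_combination (-W r₀ 0 1) * h0 - W r₀ 0 0 * h1
  obtain ⟨c, hc⟩ := exists_prod_eq_mul_prod_compl hij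
    (fun z => (⟨x z 0, x z 1⟩ : QuadraticAlgebra ℝ δ 0)) (fun z => ⟨y z 0, y z 1⟩ * Z r₀)
    (fun k z => Ring.inverse (Z r₀) * Z (Function.update r₀ k z))
  refine ⟨c, fun r => ?_⟩
  have h := eq_mul_prod_of_minors_eq_zero hu ({i, j} : Finset ι)ᶜ (fun k hk r => by
    simp only [Finset.mem_compl, Finset.mem_insert, Finset.mem_singleton, not_or] at hk
    exact hminors k hk.1 hk.2 r) r
  have hr : Z ((({i, j} : Finset ι)ᶜ).piecewise r₀ r) = Z r₀ := by
    simp only [Z, hWdef, sliceMatrix_piecewise T hij]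
  rw [hr] at h
  rw [hc, mul_assoc, mul_assoc, ← h, hxy]
  simp [Z]
  ring

theorem continuous_prod_quadraticAlgebra (s : Finset ι) (x y : ι → ℝ) :
    (Continuous fun δ : ℝ => (∏ i ∈ s, (⟨x i, y i⟩ : QuadraticAlgebra ℝ δ 0)).re) ∧
      Continuous fun δ : ℝ => (∏ i ∈ s, (⟨x i, y i⟩ : QuadraticAlgebra ℝ δ 0)).im := by
  induction s using Finset.induction_on with
  | empty =>
    simp only [Finset.prod_empty, QuadraticAlgebra.re_one, QuadraticAlgebra.im_one]
    exact ⟨continuous_const, continuous_const⟩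
  | insert i s hi ih =>
    obtain ⟨h₁, h₂⟩ := ih
    simp only [Finset.prod_insert hi, QuadraticAlgebra.re_mul, QuadraticAlgebra.im_mul]
    constructor <;> fun_prop

theorem re_add_mul_im_prod (s : Finset ι) (x y : ι → ℝ) {δ ε : ℝ} (h : ε ^ 2 = δ) :
    (∏ i ∈ s, (⟨x i, y i⟩ : QuadraticAlgebra ℝ δ 0)).re +
      ε * (∏ i ∈ s, (⟨x i, y i⟩ : QuadraticAlgebra ℝ δ 0)).im = ∏ i ∈ s, (x i + ε * y i) := by
  induction s using Finset.induction_on with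
  | empty =>
    simp only [Finset.prod_empty, QuadraticAlgebra.re_one, QuadraticAlgebra.im_one]
    ring
  | insert i s hi ih =>
    simp only [Finset.prod_insert hi, QuadraticAlgebra.re_mul, QuadraticAlgebra.im_mul, ← ih, ← h]
    ring

theorem isRankLeTwo_of_eq_smul_add_smul [Fintype ι] (i : ι) {T : (∀ i, κ i) → ℝ} (c₁ c₂ : ℝ)
    (a b : ∀ i, κ i → ℝ) (h : ∀ r, T r = c₁ * ∏ i, a i (r i) + c₂ * ∏ i, b i (r i)) :
    IsRankLeTwo T := by
  have key : ∀ (c : ℝ) (a : ∀ i, κ i → ℝ) (r : ∀ i, κ i),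
      ∏ k, Function.update a i (fun z => c * a i z) k (r k) = c * ∏ k, a k (r k) := by
    intro c a r
    rw [← Finset.mul_prod_erase _ _ (Finset.mem_univ i),
      ← Finset.mul_prod_erase _ (fun k => a k (r k)) (Finset.mem_univ i), ← mul_assoc]
    congr 1
    · simp
    · exact Finset.prod_congr rfl fun k hk => by simp [Finset.ne_of_mem_erase hk]
  exact ⟨_, _, fun r => (h r).trans (congrArg₂ _ (key c₁ a r).symm (key c₂ b r).symm)⟩

theorem IsImPure.mem_closure [Fintype ι] (i : ι) {T : (∀ i, κ i) → ℝ} (hT : IsImPure 0 T) :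
    T ∈ closure {S : (∀ i, κ i) → ℝ | IsRankLeTwo S} := by
  obtain ⟨a, ha⟩ := hT
  let f : ℝ → (∀ i, κ i) → ℝ := fun δ r =>
    (∏ k, (⟨(a k (r k)).re, (a k (r k)).im⟩ : QuadraticAlgebra ℝ δ 0)).im
  have hf : Continuous f := continuous_pi fun r => (continuous_prod_quadraticAlgebra _ _ _).2
  have hf0 : f 0 = T := funext fun r => (ha r).symm
  refine mem_closure_of_tendsto (b := nhdsWithin 0 (Set.Ioi 0)) (f := f)
    (hf0 ▸ (hf.tendsto 0).mono_left nhdsWithin_le_nhds) ?_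
  filter_upwards [self_mem_nhdsWithin] with δ hδ
  have hε : √δ ≠ 0 := (Real.sqrt_pos.2 hδ).ne'
  have hε2 : √δ ^ 2 = δ := Real.sq_sqrt (le_of_lt hδ)
  refine isRankLeTwo_of_eq_smul_add_smul i (2 * √δ)⁻¹ (-(2 * √δ)⁻¹)
    (fun k z => (a k z).re + √δ * (a k z).im) (fun k z => (a k z).re + -√δ * (a k z).im)
    fun r => ?_
  rw [← re_add_mul_im_prod _ (fun k => (a k (r k)).re) (fun k => (a k (r k)).im) hε2,
    ← re_add_mul_im_prod _ (fun k => (a k (r k)).re) (fun k => (a k (r k)).im)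
      ((neg_sq √δ).trans hε2)]
  simp only [f]
  field_simp
  ring

theorem Det222_im_mul_mul {δ : ℝ} (x y z : Fin 2 → QuadraticAlgebra ℝ δ 0) :
    Det222 (fun p q r => (x p * y q * z r).im) =
      4 * δ * ((x 0).re * (x 1).im - (x 0).im * (x 1).re) ^ 2 *
        ((y 0).re * (y 1).im - (y 0).im * (y 1).re) ^ 2 *
        ((z 0).re * (z 1).im - (z 0).im * (z 1).re) ^ 2 := by
  simp only [Det222, QuadraticAlgebra.re_mul, QuadraticAlgebra.im_mul]
  ring

theorem exists_re_mul_im_sub_ne_zero [Fintype ι] {T : (∀ i, κ i) → ℝ} {δ : ℝ}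
    {a : ∀ i, κ i → QuadraticAlgebra ℝ δ 0} (ha : ∀ r, T r = (∏ i, a i (r i)).im) {i : ι}
    (hi : ¬ MinorsVanishAt T i) : ∃ u : Fin 2 → κ i,
      (a i (u 0)).re * (a i (u 1)).im - (a i (u 0)).im * (a i (u 1)).re ≠ 0 := by
  simp only [MinorsVanishAt, not_forall] at hi
  obtain ⟨r, s, hrs⟩ := hi
  refine ⟨![r i, s i], fun h => hrs ?_⟩
  have hT : ∀ (r : ∀ i, κ i) z, T (Function.update r i z) =
      (a i z * ∏ k ∈ Finset.univ.erase i, a k (r k)).im := by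
    intro r z
    rw [ha, ← Finset.mul_prod_erase _ _ (Finset.mem_univ i), Function.update_self]
    congr 2
    exact Finset.prod_congr rfl fun k hk => by
      rw [Function.update_of_ne (Finset.ne_of_mem_erase hk)]
  have hr := hT r (r i)
  have hs := hT s (s i)
  rw [Function.update_eq_self] at hr hs
  rw [hr, hs, hT, hT]
  simp only [Matrix.cons_val_zero, Matrix.cons_val_one] at h
  generalize ∏ k ∈ Finset.univ.erase i, a k (r k) = C
  generalize ∏ k ∈ Finset.univ.erase i, a k (s k) = D
  simp only [QuadraticAlgebra.im_mul]
  linear_combination (C.im * D.re - C.re * D.im) * h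

theorem IsImPure.exists_det222_neg [Fintype ι] {T : (∀ i, κ i) → ℝ} {δ : ℝ} (hδ : δ < 0)
    (hT : IsImPure δ T) {i₁ i₂ i₃ : ι} (h₁₂ : i₁ ≠ i₂) (h₁₃ : i₁ ≠ i₃) (h₂₃ : i₂ ≠ i₃)
    (h₁ : ¬ MinorsVanishAt T i₁) (h₂ : ¬ MinorsVanishAt T i₂) (h₃ : ¬ MinorsVanishAt T i₃) :
    ∃ (u : Fin 2 → κ i₁) (v : Fin 2 → κ i₂) (w : Fin 2 → κ i₃) (j : ∀ i, κ i),
      u 0 ≠ u 1 ∧ v 0 ≠ v 1 ∧ w 0 ≠ w 1 ∧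
      Det222 (fun p q r => T (Function.update (Function.update (Function.update j i₁ (u p))
        i₂ (v q)) i₃ (w r))) < 0 := by
  obtain ⟨a, ha⟩ := hT
  obtain ⟨u, hu⟩ := exists_re_mul_im_sub_ne_zero ha h₁
  obtain ⟨v, hv⟩ := exists_re_mul_im_sub_ne_zero ha h₂
  obtain ⟨w, hw⟩ := exists_re_mul_im_sub_ne_zero ha h₃
  obtain ⟨j, hj⟩ : ∃ j, T j ≠ 0 := by
    by_contra! h
    exact h₁ fun r s => by simp only [h, mul_zero]
  refine ⟨u, v, w, j, fun h => hu (by rw [h]; ring), fun h => hv (by rw [h]; ring),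
    fun h => hw (by rw [h]; ring), ?_⟩
  set c := ∏ i ∈ ({i₁, i₂, i₃} : Finset ι)ᶜ, a i (j i) with hc
  have hN : 0 < c.re ^ 2 - δ * c.im ^ 2 := by
    by_contra! h
    have him : c.im = 0 := by
      by_contra h0
      nlinarith [sq_nonneg c.re, sq_abs c.im,
        mul_pos_of_neg_of_neg hδ (neg_neg_of_pos (pow_pos (abs_pos.2 h0) 2))]
    have hre : c.re = 0 := by
      rw [him] at h
      nlinarith
    refine hj ?_
    rw [ha, ← Finset.prod_mul_prod_compl {i₁, i₂, i₃}, ← hc,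
      show c = 0 from QuadraticAlgebra.ext hre him, mul_zero, QuadraticAlgebra.im_zero]
  have hsub : (fun p q r => T (Function.update (Function.update (Function.update j i₁ (u p))
      i₂ (v q)) i₃ (w r))) =
      fun p q r => ((a i₁ (u p) * c) * a i₂ (v q) * a i₃ (w r)).im := by
    funext p q r
    rw [ha, Finset.prod_update_three _ h₁₂ h₁₃ h₂₃, ← hc]
    congr 1
    ring
  have hdet : ((a i₁ (u 0) * c).re * (a i₁ (u 1) * c).im -
      (a i₁ (u 0) * c).im * (a i₁ (u 1) * c).re) =
      ((a i₁ (u 0)).re * (a i₁ (u 1)).im - (a i₁ (u 0)).im * (a i₁ (u 1)).re) *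
        (c.re ^ 2 - δ * c.im ^ 2) := by
    simp only [QuadraticAlgebra.re_mul, QuadraticAlgebra.im_mul]
    ring
  rw [hsub, Det222_im_mul_mul (fun p => a i₁ (u p) * c) (fun q => a i₂ (v q))
    (fun r => a i₃ (w r)), hdet]
  have hpos := mul_pos (mul_pos (pow_pos (abs_pos.2 (mul_ne_zero hu hN.ne')) 2)
    (pow_pos (abs_pos.2 hv) 2)) (pow_pos (abs_pos.2 hw) 2)
  simp only [sq_abs] at hpos
  nlinarith [mul_neg_of_neg_of_pos hδ hpos]

theorem mem_closure_of_flatteningFactors [Fintype ι] (hι : 3 ≤ Fintype.card ι)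
    {T : (∀ i, κ i) → ℝ}
    (hT : ∀ S : Finset ι, S.Nonempty → S ≠ Finset.univ → FlatteningFactors T S)
    (hdet : ∀ i₁ i₂ i₃ : ι, i₁ ≠ i₂ → i₁ ≠ i₃ → i₂ ≠ i₃ →
      ∀ (u : Fin 2 → κ i₁) (v : Fin 2 → κ i₂) (w : Fin 2 → κ i₃),
        u 0 ≠ u 1 → v 0 ≠ v 1 → w 0 ≠ w 1 → ∀ j : ∀ i, κ i,
          0 ≤ Det222 (fun p q r => T (Function.update (Function.update (Function.update j
            i₁ (u p)) i₂ (v q)) i₃ (w r)))) :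
    T ∈ closure {S : (∀ i, κ i) → ℝ | IsRankLeTwo S} := by
  classical
  have hpair : ∀ i j : ι, FlatteningFactors T {i, j} := fun i j => hT _ (by simp) fun h => by
    have h1 := Finset.card_le_two (a := i) (b := j)
    rw [h, Finset.card_univ] at h1
    omega
  set F : Finset ι := {i | ¬ MinorsVanishAt T i} with hF
  by_cases hcard : 2 < F.card
  · obtain ⟨i, j, k, hi, hj, hk, hij, hik, hjk⟩ := Finset.two_lt_card_iff.1 hcard
    simp only [hF, Finset.mem_filter, Finset.mem_univ, true_and] at hi hj hk
    obtain ⟨p, q, P, Q, x, y, hxy, hW⟩ :=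
      exists_sliceMatrix_normalForm hT hij hik.symm hjk.symm hi hj
    rcases hW with hW | ⟨δ, hδ, hW⟩
    · exact subset_closure (isRankLeTwo_of_diagonal hij hi (fun k _ _ => hpair i k) hxy
        fun r => hW _ ⟨r, rfl⟩)
    · have hIm := isImPure_of_normalForm hij hi (fun k _ _ => hpair i k) hxy hδ
        fun r => hW _ ⟨r, rfl⟩
      rcases hδ.lt_or_eq with hδ | rfl
      · obtain ⟨u, v, w, r, hu, hv, hw, hneg⟩ := hIm.exists_det222_neg hδ hij hik hjk hi hj hk
        exact absurd (hdet i j k hij hik hjk u v w hu hv hw r) hneg.not_ge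
      · exact hIm.mem_closure i
  · refine subset_closure ?_
    obtain ⟨G, hFG, hG⟩ := Finset.exists_superset_card_eq (n := 2) (not_lt.1 hcard)
      (by omega)
    obtain ⟨i, j, hij, rfl⟩ := Finset.card_eq_two.1 hG
    by_cases h0 : ∃ r, T r ≠ 0
    · obtain ⟨r, hr⟩ := h0
      refine isRankLeTwo_of_minorsVanishAt hij (by simpa using hpair i i)
        (fun k hki hkj => ?_) hr
      by_contra hk
      have := hFG (by simpa [hF] using hk : k ∈ F)
      simp [hki, hkj] at this
    · push Not at h0
      exact isRankLeTwo_of_eq_smul_add_smul i 0 0 0 0 fun r => by simp [h0]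

end Tensor

theorem flatteningFactors_of_rank_flattening_le_two {d : ℕ} {n : Fin d → ℕ}
    {T : (∀ i : Fin d, Fin (n i)) → ℝ} {S : Finset (Fin d)} (h : (flattening T S).rank ≤ 2) :
    FlatteningFactors T S := by
  obtain ⟨U, V, hUV⟩ := Matrix.exists_eq_add_of_rank_le_two _ h
  refine ⟨fun l r => U l fun i => r i, fun l c => V l fun i => c i, fun r c => ?_⟩
  rw [← hUV]
  rfl

/-- A real tensor has real border rank at most two if and only if all of its flattenings
have rank at most two and all of its 2×2×2 sub-hyperdeterminants are non-negative. -/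
theorem realBorderRankTwo_iff_flattenings_and_subhyperdets
    (d : ℕ) (hd : 3 ≤ d) (n : Fin d → ℕ) (hn : ∀ i, 1 ≤ n i)
    (T : (∀ i : Fin d, Fin (n i)) → ℝ) :
    T ∈ closure {S : (∀ i : Fin d, Fin (n i)) → ℝ |
        ∃ a b : ∀ i : Fin d, Fin (n i) → ℝ,
          ∀ j, S j = (∏ i, a i (j i)) + (∏ i, b i (j i))}
    ↔ ((∀ S : Finset (Fin d), S.Nonempty → S ≠ Finset.univ → (flattening T S).rank ≤ 2)
      ∧ (∀ (i₁ i₂ i₃ : Fin d), i₁ ≠ i₂ → i₁ ≠ i₃ → i₂ ≠ i₃ →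
          ∀ (u : Fin 2 → Fin (n i₁)) (v : Fin 2 → Fin (n i₂)) (w : Fin 2 → Fin (n i₃)),
            u 0 ≠ u 1 → v 0 ≠ v 1 → w 0 ≠ w 1 →
            ∀ j₀ : ∀ i : Fin d, Fin (n i),
              0 ≤ Det222 (subTensor222 T i₁ i₂ i₃ u v w j₀))) := by
  constructor
  · intro hT
    refine ⟨fun S _ _ => ?_, fun i₁ i₂ i₃ h₁₂ h₁₃ h₂₃ u v w _ _ _ j₀ => ?_⟩
    · exact closure_minimal (fun S' hS' => IsRankLeTwo.rank_flattening_le hS' S)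
        (isClosed_setOf_rank_flattening_le S) hT
    · exact closure_minimal (fun S' hS' => IsRankLeTwo.det222_nonneg hS' h₁₂ h₁₃ h₂₃ u v w j₀)
        (isClosed_setOf_det222_nonneg i₁ i₂ i₃ u v w j₀) hT
  · rintro ⟨hrank, hdet⟩
    exact mem_closure_of_flatteningFactors (by simpa using hd)
      (fun S hS hS' => flatteningFactors_of_rank_flattening_le_two (hrank S hS hS')) hdet
end

section
/- Let d ≥ 3 and n : Fin d → ℕ with n i ≥ 1 for all i, and let T : (∀ i : Fin d, Fin (n i)) → ℝ be a real tensor such that every flattening of T has matrix rank at most 2 and every 2×2×2 sub-hyperdeterminant of T is non-negative. If moreover at least one flattening of T has matrix rank exactly 2 and at least one 2×2×2 sub-hyperdeterminant of T is strictly positive, then the real rank of T is exactly two: there exist families a, b with a i, b i : Fin (n i) → ℝ such that T j = (∏ i, a i (j i)) + (∏ i, b i (j i)) for all j, and there is no family c with T j = ∏ i, c i (j i) for all j. -/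
open Module

/-- A tensor is a pure product when it has an outer product decomposition with one term. -/
def IsPureProduct {d : ℕ} {n : Fin d → ℕ} (F : (∀ i : Fin d, Fin (n i)) → ℝ) : Prop :=
  ∃ a : ∀ i : Fin d, Fin (n i) → ℝ, ∀ j, F j = ∏ i, a i (j i)

namespace IsPureProduct

variable {d : ℕ} {n : Fin d → ℕ} {F G : (∀ i : Fin d, Fin (n i)) → ℝ}

theorem mul (hF : IsPureProduct F) (hG : IsPureProduct G) :
    IsPureProduct fun j => F j * G j := by
  obtain ⟨a, ha⟩ := hF
  obtain ⟨b, hb⟩ := hG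
  exact ⟨fun i x => a i x * b i x, fun j => by simp only [ha, hb, Finset.prod_mul_distrib]⟩

theorem of_axis (i : Fin d) (f : Fin (n i) → ℝ) :
    IsPureProduct fun j : (∀ i : Fin d, Fin (n i)) => f (j i) := by
  refine ⟨fun k x => if h : k = i then f (h ▸ x) else 1, fun j => ?_⟩
  rw [Finset.prod_eq_single i (fun k _ hk => by simp [hk]) (by simp)]
  simp

/-- A tensor whose single-axis flattenings are all proportional to the fibre through a
point where the tensor does not vanish is a pure product. -/
theorem of_exchange (hd : 0 < d) (p : ∀ i : Fin d, Fin (n i)) (hp : F p ≠ 0)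
    (h : ∀ k j, F j * F p = F (Function.update j k (p k)) * F (Function.update p k (j k))) :
    IsPureProduct F := by
  have key : ∀ (S : Finset (Fin d)) (j : ∀ i : Fin d, Fin (n i)),
      F j = F (S.piecewise p j) * ∏ k ∈ S, (F (Function.update p k (j k)) / F p) := by
    intro S j
    induction S using Finset.induction_on with
    | empty => simp
    | insert k S hk ih =>
      rw [ih, Finset.prod_insert hk, ← mul_assoc]
      congr 1
      rw [mul_div_assoc', eq_div_iff hp, h k, Finset.piecewise_insert,
        Finset.piecewise_eq_of_notMem _ _ _ hk]
  have hconst : IsPureProduct fun _ : (∀ i : Fin d, Fin (n i)) => F p :=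
    of_axis ⟨0, hd⟩ fun _ => F p
  have hprod : IsPureProduct fun j => ∏ k, (F (Function.update p k (j k)) / F p) :=
    ⟨fun k x => F (Function.update p k x) / F p, fun _ => rfl⟩
  obtain ⟨a, ha⟩ := hconst.mul hprod
  refine ⟨a, fun j => ?_⟩
  rw [← ha, key Finset.univ j]
  simp

theorem det222_subTensor222_eq_zero (hF : IsPureProduct F) {i₁ i₂ i₃ : Fin d}
    (h₁₂ : i₁ ≠ i₂) (h₁₃ : i₁ ≠ i₃) (h₂₃ : i₂ ≠ i₃) (u : Fin 2 → Fin (n i₁))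
    (v : Fin 2 → Fin (n i₂)) (w : Fin 2 → Fin (n i₃)) (j₀ : ∀ i : Fin d, Fin (n i)) :
    Det222 (subTensor222 F i₁ i₂ i₃ u v w j₀) = 0 := by
  obtain ⟨a, ha⟩ := hF
  have key : ∀ p q r, subTensor222 F i₁ i₂ i₃ u v w j₀ p q r =
      a i₁ (u p) * a i₂ (v q) * a i₃ (w r) *
        ∏ i ∈ ((Finset.univ.erase i₁).erase i₂).erase i₃, a i (j₀ i) := by
    intro p q r
    rw [subTensor222, ha, ← Finset.mul_prod_erase _ _ (Finset.mem_univ i₁),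
      ← Finset.mul_prod_erase _ _ (show i₂ ∈ Finset.univ.erase i₁ by simp [h₁₂.symm]),
      ← Finset.mul_prod_erase _ _
        (show i₃ ∈ (Finset.univ.erase i₁).erase i₂ by simp [h₁₃.symm, h₂₃.symm])]
    rw [Finset.prod_congr rfl (g := fun i => a i (j₀ i))]
    · simp [h₁₂, h₁₃, h₂₃, mul_assoc]
    · intro i hi
      simp only [Finset.mem_erase] at hi
      simp [hi.1, hi.2.1, hi.2.2.1]
  simp only [Det222, key]
  ring

end IsPureProduct

section RealDecomposition

/-- A real binary quadratic form with positive discriminant has two independent zeros. -/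
theorem exists_independent_zeros_of_discrim_pos_s4 (A B C : ℝ) (h : 0 < discrim A B C) :
    ∃ x y x' y' : ℝ, A * x ^ 2 + B * x * y + C * y ^ 2 = 0 ∧
      A * x' ^ 2 + B * x' * y' + C * y' ^ 2 = 0 ∧ x * y' - x' * y ≠ 0 := by
  rw [discrim] at h
  by_cases hA : A = 0
  · subst hA
    have hB : B ≠ 0 := by rintro rfl; simp at h
    exact ⟨1, 0, -C, B, by ring, by ring, by simpa using hB⟩
  · have hs := Real.sq_sqrt h.le
    have hs0 := (Real.sqrt_pos.2 h).ne'
    set s := √(B ^ 2 - 4 * A * C)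
    refine ⟨-B + s, 2 * A, -B - s, 2 * A, ?_, ?_, ?_⟩
    · linear_combination A * hs
    · linear_combination A * hs
    · have : (-B + s) * (2 * A) - (-B - s) * (2 * A) = 4 * A * s := by ring
      rw [this]
      positivity

/-- A singular `2 × 2` matrix is an outer product. -/
theorem exists_outer_product_of_det_eq_zero (m : Fin 2 → Fin 2 → ℝ)
    (h : m 0 0 * m 1 1 - m 0 1 * m 1 0 = 0) :
    ∃ a b : Fin 2 → ℝ, ∀ p q, m p q = a p * b q := by
  by_cases h0 : m 0 0 = 0 ∧ m 0 1 = 0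
  · refine ⟨![0, 1], m 1, ?_⟩
    simp [Fin.forall_fin_two, h0]
  · by_cases h00 : m 0 0 = 0
    · have h01 : m 0 1 ≠ 0 := fun h' => h0 ⟨h00, h'⟩
      refine ⟨![1, m 1 1 / m 0 1], m 0, ?_⟩
      have h10 : m 1 0 = 0 := by simpa [h00, h01] using h
      simp [Fin.forall_fin_two, h00, h01, h10]
    · refine ⟨![1, m 1 0 / m 0 0], m 0, ?_⟩
      simp [Fin.forall_fin_two, h00]
      field_simp
      linear_combination h

/-- The value of a `2 × 2 × 2` tensor, as a trilinear form, at three vectors. -/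
def contract222 (t : Fin 2 → Fin 2 → Fin 2 → ℝ) (a b c : Fin 2 → ℝ) : ℝ :=
  ∑ p, a p * ∑ q, b q * ∑ r, c r * t p q r

/-- A real `2 × 2 × 2` tensor with positive hyperdeterminant is diagonal with respect to
suitable pairs of vectors. -/
theorem exists_diagonalizing_of_det222_pos (t : Fin 2 → Fin 2 → Fin 2 → ℝ)
    (h : 0 < Det222 t) :
    ∃ α₁ β₁ α₂ β₂ α₃ β₃ : Fin 2 → ℝ,
      contract222 t α₁ α₂ α₃ = 1 ∧ contract222 t β₁ β₂ β₃ = 1 ∧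
      contract222 t α₁ β₂ α₃ = 0 ∧ contract222 t β₁ α₂ α₃ = 0 ∧
      contract222 t β₁ β₂ α₃ = 0 ∧ contract222 t α₁ α₂ β₃ = 0 ∧
      contract222 t α₁ β₂ β₃ = 0 ∧ contract222 t β₁ α₂ β₃ = 0 := by
  let A := t 0 0 0 * t 1 1 0 - t 0 1 0 * t 1 0 0
  let B := t 0 0 0 * t 1 1 1 + t 0 0 1 * t 1 1 0 - t 0 1 0 * t 1 0 1 - t 0 1 1 * t 1 0 0
  let C := t 0 0 1 * t 1 1 1 - t 0 1 1 * t 1 0 1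
  have hdisc : discrim A B C = Det222 t := by
    simp only [discrim, Det222, A, B, C]; ring
  obtain ⟨x, y, x', y', h1, h2, h3⟩ :=
    exists_independent_zeros_of_discrim_pos_s4 A B C (hdisc ▸ h)
  obtain ⟨a, b, hab⟩ := exists_outer_product_of_det_eq_zero
    (fun p q => x * t p q 0 + y * t p q 1) (by
      rw [← h1]; simp only [A, B, C]; ring)
  obtain ⟨c, e, hce⟩ := exists_outer_product_of_det_eq_zero
    (fun p q => x' * t p q 0 + y' * t p q 1) (by
      rw [← h2]; simp only [A, B, C]; ring)
  have hα : ∀ f g : Fin 2 → ℝ, contract222 t f g ![x, y] =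
      (f 0 * a 0 + f 1 * a 1) * (g 0 * b 0 + g 1 * b 1) := by
    intro f g
    simp only [contract222, Fin.sum_univ_two, Matrix.cons_val_zero, Matrix.cons_val_one, hab]
    ring
  have hβ : ∀ f g : Fin 2 → ℝ, contract222 t f g ![x', y'] =
      (f 0 * c 0 + f 1 * c 1) * (g 0 * e 0 + g 1 * e 1) := by
    intro f g
    simp only [contract222, Fin.sum_univ_two, Matrix.cons_val_zero, Matrix.cons_val_one, hce]
    ring
  let D := (c 1 * a 0 - c 0 * a 1) * (e 1 * b 0 - e 0 * b 1)
  have hpolar : D = 2 * A * x * x' + B * (x * y' + x' * y) + 2 * C * y * y' := by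
    have : D = a 0 * b 0 * (c 1 * e 1) + a 1 * b 1 * (c 0 * e 0)
      - a 0 * b 1 * (c 1 * e 0) - a 1 * b 0 * (c 0 * e 1) := by simp only [D]; ring
    rw [this]
    simp only [← hab, ← hce, A, B, C]
    ring
  have hD : D ≠ 0 := by
    have hsq : D ^ 2 = Det222 t * (x * y' - x' * y) ^ 2 := by
      rw [hpolar, ← hdisc, discrim]
      linear_combination (4 * (A * x' ^ 2 + B * x' * y' + C * y' ^ 2)) * h1
    intro h0
    rw [h0] at hsq
    have : 0 < Det222 t * (x * y' - x' * y) ^ 2 := by positivity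
    simp [← hsq] at this
  refine ⟨![c 1 / D, -c 0 / D], ![a 1 / D, -a 0 / D], ![e 1, -e 0], ![b 1, -b 0],
    ![x, y], ![x', y'], ?_⟩
  simp only [hα, hβ, Matrix.cons_val_zero, Matrix.cons_val_one]
  refine ⟨?_, ?_, ?_, ?_, ?_, ?_, ?_, ?_⟩ <;> field_simp <;> simp only [D] <;> ring

end RealDecomposition

section LowRank

/-- In a space of dimension at most two, a biorthogonal system gives coordinates. -/
theorem eq_smul_add_smul_of_biorthogonal {E : Type*} [AddCommGroup E] [Module ℝ E]
    [FiniteDimensional ℝ E] {V : Submodule ℝ E} (hV : finrank ℝ V ≤ 2) {f g : E}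
    (hf : f ∈ V) (hg : g ∈ V) (φ ψ : E →ₗ[ℝ] ℝ) (hφf : φ f = 1) (hφg : φ g = 0)
    (hψf : ψ f = 0) (hψg : ψ g = 1) {h : E} (hh : h ∈ V) : h = φ h • f + ψ h • g := by
  have hli : LinearIndependent ℝ ![f, g] := by
    rw [LinearIndependent.pair_iff]
    intro s t hst
    have h1 := congrArg φ hst
    have h2 := congrArg ψ hst
    simp only [map_add, map_smul, map_zero, hφf, hφg, hψf, hψg, smul_eq_mul] at h1 h2
    constructor <;> linarith
  have hspan : Submodule.span ℝ (Set.range ![f, g]) = V := by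
    apply Submodule.eq_of_le_of_finrank_le
    · rw [Submodule.span_le]
      rintro _ ⟨i, rfl⟩
      fin_cases i
      · exact hf
      · exact hg
    · rw [finrank_span_eq_card hli]
      simpa using hV
  rw [← hspan, Matrix.range_cons, Matrix.range_cons, Matrix.range_empty, Set.union_empty,
    Set.singleton_union, Submodule.mem_span_pair] at hh
  obtain ⟨s, t, rfl⟩ := hh
  simp [hφf, hφg, hψf, hψg]

/-- Pairing with a weight vector. -/
def weightedSum {ι : Type*} [Fintype ι] (a : ι → ℝ) : (ι → ℝ) →ₗ[ℝ] ℝ where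
  toFun h := ∑ x, a x * h x
  map_add' h k := by simp [mul_add, Finset.sum_add_distrib]
  map_smul' s h := by simp [Finset.mul_sum, mul_left_comm]

theorem weightedSum_apply {ι : Type*} [Fintype ι] (a h : ι → ℝ) :
    weightedSum a h = ∑ x, a x * h x := rfl

/-- Iterated pairing of a function of two variables with two weight vectors. -/
def weightedSum₂ {ι κ : Type*} [Fintype ι] [Fintype κ] (a : ι → ℝ) (b : κ → ℝ) :
    (ι × κ → ℝ) →ₗ[ℝ] ℝ :=
  weightedSum fun z => a z.1 * b z.2

theorem weightedSum₂_apply {ι κ : Type*} [Fintype ι] [Fintype κ] (a : ι → ℝ) (b : κ → ℝ)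
    (X : ι × κ → ℝ) :
    weightedSum₂ a b X = weightedSum a fun x => weightedSum b fun y => X (x, y) := by
  simp only [weightedSum₂, weightedSum_apply, Fintype.sum_prod_type, Finset.mul_sum, mul_assoc]

theorem weightedSum₂_apply_symm {ι κ : Type*} [Fintype ι] [Fintype κ] (a : ι → ℝ)
    (b : κ → ℝ) (X : ι × κ → ℝ) :
    weightedSum₂ a b X = weightedSum b fun y => weightedSum a fun x => X (x, y) := by
  simp only [weightedSum₂, weightedSum_apply, Fintype.sum_prod_type_right, Finset.mul_sum,
    mul_assoc, mul_left_comm]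

theorem weightedSum_mem {ι κ : Type*} [Fintype ι] (a : ι → ℝ) {V : Submodule ℝ (κ → ℝ)}
    {F : ι → κ → ℝ} (hF : ∀ x, F x ∈ V) : (fun y => weightedSum a fun x => F x y) ∈ V := by
  have : (fun y => weightedSum a fun x => F x y) = ∑ x, a x • F x := by
    ext y
    simp [weightedSum_apply]
  rw [this]
  exact V.sum_mem fun x _ => V.smul_mem _ (hF x)

/-- A family of matrices spanning a space of dimension at most two, whose rows and columns
also span spaces of dimension at most two, consists of combinations of two rank-one
matrices as soon as two of its combinations are diagonal for suitable weights. -/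
theorem exists_simultaneous_diagonalization {K ι κ : Type*} [Fintype ι] [Fintype κ]
    (M : K → ι × κ → ℝ) {V₁ : Submodule ℝ (ι → ℝ)} {V₂ : Submodule ℝ (κ → ℝ)}
    {V : Submodule ℝ (ι × κ → ℝ)}
    (hV₁ : finrank ℝ V₁ ≤ 2) (hV₂ : finrank ℝ V₂ ≤ 2) (hV : finrank ℝ V ≤ 2)
    (hM : ∀ c, M c ∈ V) (hM₁ : ∀ X ∈ V, ∀ y, (fun x => X (x, y)) ∈ V₁)
    (hM₂ : ∀ X ∈ V, ∀ x, (fun y => X (x, y)) ∈ V₂)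
    {α₁ β₁ : ι → ℝ} {α₂ β₂ : κ → ℝ} {X Y : ι × κ → ℝ} (hX : X ∈ V) (hY : Y ∈ V)
    (hX₁ : weightedSum₂ α₁ α₂ X = 1) (hX₂ : weightedSum₂ α₁ β₂ X = 0)
    (hX₃ : weightedSum₂ β₁ α₂ X = 0) (hX₄ : weightedSum₂ β₁ β₂ X = 0)
    (hY₁ : weightedSum₂ α₁ α₂ Y = 0) (hY₂ : weightedSum₂ α₁ β₂ Y = 0)
    (hY₃ : weightedSum₂ β₁ α₂ Y = 0) (hY₄ : weightedSum₂ β₁ β₂ Y = 1) :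
    ∃ (f₁ g₁ : ι → ℝ) (f₂ g₂ : κ → ℝ),
      weightedSum α₁ f₁ = 1 ∧ weightedSum β₁ f₁ = 0 ∧
      weightedSum α₁ g₁ = 0 ∧ weightedSum β₁ g₁ = 1 ∧
      weightedSum α₂ f₂ = 1 ∧ weightedSum β₂ f₂ = 0 ∧
      weightedSum α₂ g₂ = 0 ∧ weightedSum β₂ g₂ = 1 ∧
      ∀ c x y, M c (x, y) = weightedSum₂ α₁ α₂ (M c) * (f₁ x * f₂ y) +
        weightedSum₂ β₁ β₂ (M c) * (g₁ x * g₂ y) := by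
  let f₁ : ι → ℝ := fun x => weightedSum α₂ fun y => X (x, y)
  let g₁ : ι → ℝ := fun x => weightedSum β₂ fun y => Y (x, y)
  let f₂ : κ → ℝ := fun y => weightedSum α₁ fun x => X (x, y)
  let g₂ : κ → ℝ := fun y => weightedSum β₁ fun x => Y (x, y)
  have hf₁ : f₁ ∈ V₁ := weightedSum_mem α₂ fun y => hM₁ X hX y
  have hg₁ : g₁ ∈ V₁ := weightedSum_mem β₂ fun y => hM₁ Y hY y
  have hf₂ : f₂ ∈ V₂ := weightedSum_mem α₁ fun x => hM₂ X hX x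
  have hg₂ : g₂ ∈ V₂ := weightedSum_mem β₁ fun x => hM₂ Y hY x
  have e₁ : weightedSum α₁ f₁ = 1 := by rw [← hX₁, weightedSum₂_apply]
  have e₂ : weightedSum β₁ f₁ = 0 := by rw [← hX₃, weightedSum₂_apply]
  have e₃ : weightedSum α₁ g₁ = 0 := by rw [← hY₂, weightedSum₂_apply]
  have e₄ : weightedSum β₁ g₁ = 1 := by rw [← hY₄, weightedSum₂_apply]
  have e₅ : weightedSum α₂ f₂ = 1 := by rw [← hX₁, weightedSum₂_apply_symm]
  have e₆ : weightedSum β₂ f₂ = 0 := by rw [← hX₂, weightedSum₂_apply_symm]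
  have e₇ : weightedSum α₂ g₂ = 0 := by rw [← hY₃, weightedSum₂_apply_symm]
  have e₈ : weightedSum β₂ g₂ = 1 := by rw [← hY₄, weightedSum₂_apply_symm]
  have expand : ∀ Z ∈ V, ∀ x y, Z (x, y) =
      (weightedSum₂ α₁ α₂ Z * f₂ y + weightedSum₂ α₁ β₂ Z * g₂ y) * f₁ x +
      (weightedSum₂ β₁ α₂ Z * f₂ y + weightedSum₂ β₁ β₂ Z * g₂ y) * g₁ x := by
    intro Z hZ x y
    have h₁ := congrFun (eq_smul_add_smul_of_biorthogonal hV₁ hf₁ hg₁ (weightedSum α₁)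
      (weightedSum β₁) e₁ e₃ e₂ e₄ (hM₁ Z hZ y)) x
    have h₂ := fun a : ι → ℝ => congrFun (eq_smul_add_smul_of_biorthogonal hV₂ hf₂ hg₂
      (weightedSum α₂) (weightedSum β₂) e₅ e₇ e₆ e₈
      (weightedSum_mem a fun x => hM₂ Z hZ x)) y
    simp only [Pi.add_apply, Pi.smul_apply, smul_eq_mul, ← weightedSum₂_apply_symm] at h₁ h₂
    rw [h₁, h₂ α₁, h₂ β₁]
  refine ⟨f₁, g₁, f₂, g₂, e₁, e₂, e₃, e₄, e₅, e₆, e₇, e₈, fun c x y => ?_⟩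
  have h := congrFun (eq_smul_add_smul_of_biorthogonal hV hX hY (weightedSum₂ α₁ α₂)
    (weightedSum₂ β₁ β₂) hX₁ hY₁ hX₄ hY₄ (hM c)) (x, y)
  have hXe := expand X hX x y
  have hYe := expand Y hY x y
  rw [hX₁, hX₂, hX₃, hX₄] at hXe
  rw [hY₁, hY₂, hY₃, hY₄] at hYe
  simp only [Pi.add_apply, Pi.smul_apply, smul_eq_mul] at h
  rw [h, hXe, hYe]
  ring

end LowRank

section Slices

variable {d : ℕ} {n : Fin d → ℕ}

/-- The space spanned by the one-dimensional fibres of a tensor along an axis. -/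
def fibreSpan (T : (∀ i : Fin d, Fin (n i)) → ℝ) (i : Fin d) : Submodule ℝ (Fin (n i) → ℝ) :=
  Submodule.span ℝ (Set.range fun c x => T (Function.update c i x))

/-- The space spanned by the two-dimensional slices of a tensor along a pair of axes. -/
def sliceSpan (T : (∀ i : Fin d, Fin (n i)) → ℝ) (i k : Fin d) :
    Submodule ℝ (Fin (n i) × Fin (n k) → ℝ) :=
  Submodule.span ℝ (Set.range fun c z => T (Function.update (Function.update c i z.1) k z.2))

theorem finrank_span_piecewise_le_rank {ι : Type*} [Finite ι]
    (T : (∀ i : Fin d, Fin (n i)) → ℝ) (S : Finset (Fin d)) (e : ι → ∀ i : Fin d, Fin (n i)) :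
    finrank ℝ (Submodule.span ℝ (Set.range fun c z => T (S.piecewise (e z) c))) ≤
      (flattening T S).rank := by
  let L : ((∀ i : {i : Fin d // i ∈ S}, Fin (n i.1)) → ℝ) →ₗ[ℝ] (ι → ℝ) :=
    LinearMap.funLeft ℝ ℝ fun z i => e z i.1
  rw [Matrix.rank_eq_finrank_span_cols]
  refine le_trans (Submodule.finrank_mono ?_) (Submodule.finrank_map_le L _)
  rw [Submodule.span_le]
  rintro _ ⟨c, rfl⟩
  refine ⟨(flattening T S).col fun i => c i.1, Submodule.subset_span ⟨_, rfl⟩, ?_⟩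
  ext z
  simp only [L, LinearMap.funLeft_apply, Matrix.col_apply, flattening]
  congr 1

theorem finrank_fibreSpan_le_rank (T : (∀ i : Fin d, Fin (n i)) → ℝ)
    (j₀ : ∀ i : Fin d, Fin (n i)) (i : Fin d) :
    finrank ℝ (fibreSpan T i) ≤ (flattening T {i}).rank := by
  have h := finrank_span_piecewise_le_rank T {i} (fun x => Function.update j₀ i x)
  suffices fibreSpan T i = Submodule.span ℝ (Set.range fun c x =>
      T (({i} : Finset (Fin d)).piecewise (Function.update j₀ i x) c)) by rwa [this]
  rw [fibreSpan]
  congr! 5 with c x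
  ext k
  by_cases hk : k = i
  · subst hk; simp
  · simp [hk]

theorem finrank_sliceSpan_le_rank (T : (∀ i : Fin d, Fin (n i)) → ℝ)
    (j₀ : ∀ i : Fin d, Fin (n i)) (i k : Fin d) :
    finrank ℝ (sliceSpan T i k) ≤ (flattening T {i, k}).rank := by
  have h := finrank_span_piecewise_le_rank T {i, k}
    (fun z : Fin (n i) × Fin (n k) => Function.update (Function.update j₀ i z.1) k z.2)
  suffices sliceSpan T i k = Submodule.span ℝ (Set.range fun c (z : Fin (n i) × Fin (n k)) =>
      T (({i, k} : Finset (Fin d)).piecewise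
        (Function.update (Function.update j₀ i z.1) k z.2) c)) by rwa [this]
  rw [sliceSpan]
  congr! 5 with c z
  ext l
  by_cases hl : l = k
  · subst hl; simp
  · by_cases hl' : l = i
    · subst hl'; simp [hl]
    · simp [hl, hl']

theorem fibre_left_mem_of_mem_sliceSpan {T : (∀ i : Fin d, Fin (n i)) → ℝ} {i k : Fin d}
    (hik : i ≠ k) {X : Fin (n i) × Fin (n k) → ℝ} (hX : X ∈ sliceSpan T i k) (y : Fin (n k)) :
    (fun x => X (x, y)) ∈ fibreSpan T i := by
  suffices sliceSpan T i k ≤ (fibreSpan T i).comap (LinearMap.funLeft ℝ ℝ fun x => (x, y)) from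
    this hX
  rw [sliceSpan, Submodule.span_le]
  rintro _ ⟨c, rfl⟩
  refine Submodule.subset_span ⟨Function.update c k y, ?_⟩
  ext x
  simp [LinearMap.funLeft_apply, Function.update_comm hik]

theorem fibre_right_mem_of_mem_sliceSpan {T : (∀ i : Fin d, Fin (n i)) → ℝ} {i k : Fin d}
    {X : Fin (n i) × Fin (n k) → ℝ} (hX : X ∈ sliceSpan T i k) (x : Fin (n i)) :
    (fun y => X (x, y)) ∈ fibreSpan T k := by
  suffices sliceSpan T i k ≤ (fibreSpan T k).comap (LinearMap.funLeft ℝ ℝ fun y => (x, y)) from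
    this hX
  rw [sliceSpan, Submodule.span_le]
  rintro _ ⟨c, rfl⟩
  exact Submodule.subset_span ⟨Function.update c i x, rfl⟩

/-- The coefficient of one of the two rank-one slices in the slices of a tensor along two
axes is a pure product. -/
theorem isPureProduct_coefficient {T A B : (∀ i : Fin d, Fin (n i)) → ℝ} {i k : Fin d}
    (hik : i ≠ k) (hrank : ∀ l, l ≠ i → finrank ℝ (sliceSpan T i l) ≤ 2)
    (hAi : ∀ c x, A (Function.update c i x) = A c) (hAk : ∀ c y, A (Function.update c k y) = A c)
    (hBi : ∀ c x, B (Function.update c i x) = B c) (hBk : ∀ c y, B (Function.update c k y) = B c)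
    {α₁ β₁ f₁ g₁ : Fin (n i) → ℝ} {α₂ β₂ f₂ g₂ : Fin (n k) → ℝ}
    (hαf : weightedSum α₁ f₁ = 1) (hβf : weightedSum β₁ f₁ = 0)
    (hαg : weightedSum α₁ g₁ = 0) (hβg : weightedSum β₁ g₁ = 1)
    (hαf' : weightedSum α₂ f₂ = 1) (hβf' : weightedSum β₂ f₂ = 0)
    (hαg' : weightedSum α₂ g₂ = 0) (hβg' : weightedSum β₂ g₂ = 1)
    (hT : ∀ j, T j = A j * (f₁ (j i) * f₂ (j k)) + B j * (g₁ (j i) * g₂ (j k)))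
    (hA : ∃ c, A c ≠ 0) (hB : ∃ c, B c ≠ 0) : IsPureProduct A := by
  obtain ⟨p, hp⟩ := hA
  obtain ⟨q, hq⟩ := hB
  refine IsPureProduct.of_exchange (lt_of_le_of_lt (Nat.zero_le _) i.2) p hp fun l j => ?_
  by_cases hli : l = i
  · subst hli; rw [hAi, hAi]
  by_cases hlk : l = k
  · subst hlk; rw [hAk, hAk]
  have hslice : ∀ (γ : Fin (n k) → ℝ) (c : ∀ i : Fin d, Fin (n i)),
      (fun z : Fin (n i) × Fin (n l) =>
        weightedSum γ f₂ * (A (Function.update c l z.2) * f₁ z.1) +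
        weightedSum γ g₂ * (B (Function.update c l z.2) * g₁ z.1)) ∈ sliceSpan T i l := by
    intro γ c
    convert weightedSum_mem γ (V := sliceSpan T i l) (F := fun y z =>
      T (Function.update (Function.update (Function.update c k y) i z.1) l z.2))
      (fun y => Submodule.subset_span ⟨_, rfl⟩) using 1
    ext z
    have hupd : ∀ y, Function.update (Function.update (Function.update c k y) i z.1) l z.2 =
        Function.update (Function.update (Function.update c l z.2) k y) i z.1 := by
      intro y
      rw [Function.update_comm (Ne.symm hli), Function.update_comm (Ne.symm hlk)]
    simp only [hupd, hT, hAi, hAk, hBi, hBk, Function.update_self,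
      Function.update_of_ne hik.symm, weightedSum_apply, Finset.sum_mul, ← Finset.sum_add_distrib]
    refine Finset.sum_congr rfl fun y _ => ?_
    ring
  have hα : ∀ c, (fun z : Fin (n i) × Fin (n l) => A (Function.update c l z.2) * f₁ z.1) ∈
      sliceSpan T i l := fun c => by simpa [hαf', hαg'] using hslice α₂ c
  have hβ : ∀ c, (fun z : Fin (n i) × Fin (n l) => B (Function.update c l z.2) * g₁ z.1) ∈
      sliceSpan T i l := fun c => by simpa [hβf', hβg'] using hslice β₂ c
  have hpair : ∀ (γ : Fin (n i) → ℝ) (s : Fin (n l)) (h : Fin (n i) → ℝ)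
      (F : (∀ i : Fin d, Fin (n i)) → ℝ) (c : ∀ i : Fin d, Fin (n i)),
      weightedSum₂ γ (Pi.single s 1) (fun z => F (Function.update c l z.2) * h z.1) =
        F (Function.update c l s) * weightedSum γ h := by
    intro γ s h F c
    simp only [weightedSum₂_apply, weightedSum_apply, Pi.single_apply, ite_mul, one_mul, zero_mul,
      Finset.sum_ite_eq', Finset.mem_univ, if_true, Finset.mul_sum]
    exact Finset.sum_congr rfl fun x _ => by ring
  have hex := eq_smul_add_smul_of_biorthogonal (hrank l hli)
    ((sliceSpan T i l).smul_mem (A p)⁻¹ (hα p)) ((sliceSpan T i l).smul_mem (B q)⁻¹ (hβ q))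
    (weightedSum₂ α₁ (Pi.single (p l) 1)) (weightedSum₂ β₁ (Pi.single (q l) 1))
    (by rw [map_smul, hpair, hαf, Function.update_eq_self]; simp [hp])
    (by rw [map_smul, hpair, hαg]; simp)
    (by rw [map_smul, hpair, hβf]; simp)
    (by rw [map_smul, hpair, hβg, Function.update_eq_self]; simp [hq])
    (hα j)
  rw [hpair, hpair, hαf, hβf] at hex
  have hcon := congrArg (weightedSum₂ α₁ (Pi.single (j l) 1)) hex
  rw [map_add, map_smul, map_smul, map_smul, hpair, hpair, hαf, Function.update_eq_self] at hcon
  simp only [mul_one, mul_zero, zero_mul, add_zero, smul_eq_mul] at hcon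
  rw [hcon]
  field_simp

end Slices

/-- If all flattenings of a real tensor have rank at most two, all 2×2×2
sub-hyperdeterminants are non-negative, at least one flattening has rank exactly two and
at least one 2×2×2 sub-hyperdeterminant is strictly positive, then the tensor has real
rank exactly two. -/
theorem realRank_eq_two_of_flattenings_and_subhyperdets
    (d : ℕ) (hd : 3 ≤ d) (n : Fin d → ℕ) (hn : ∀ i, 1 ≤ n i)
    (T : (∀ i : Fin d, Fin (n i)) → ℝ)
    (hflat : ∀ S : Finset (Fin d), S.Nonempty → S ≠ Finset.univ → (flattening T S).rank ≤ 2)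
    (hhyp : ∀ (i₁ i₂ i₃ : Fin d), i₁ ≠ i₂ → i₁ ≠ i₃ → i₂ ≠ i₃ →
      ∀ (u : Fin 2 → Fin (n i₁)) (v : Fin 2 → Fin (n i₂)) (w : Fin 2 → Fin (n i₃)),
        u 0 ≠ u 1 → v 0 ≠ v 1 → w 0 ≠ w 1 →
        ∀ j₀ : ∀ i : Fin d, Fin (n i), 0 ≤ Det222 (subTensor222 T i₁ i₂ i₃ u v w j₀))
    (hflat2 : ∃ S : Finset (Fin d), S.Nonempty ∧ S ≠ Finset.univ ∧ (flattening T S).rank = 2)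
    (hhyp2 : ∃ (i₁ i₂ i₃ : Fin d), i₁ ≠ i₂ ∧ i₁ ≠ i₃ ∧ i₂ ≠ i₃ ∧
      ∃ (u : Fin 2 → Fin (n i₁)) (v : Fin 2 → Fin (n i₂)) (w : Fin 2 → Fin (n i₃)),
        u 0 ≠ u 1 ∧ v 0 ≠ v 1 ∧ w 0 ≠ w 1 ∧
        ∃ j₀ : ∀ i : Fin d, Fin (n i), 0 < Det222 (subTensor222 T i₁ i₂ i₃ u v w j₀)) :
    (∃ a b : ∀ i : Fin d, Fin (n i) → ℝ,
        ∀ j, T j = (∏ i, a i (j i)) + (∏ i, b i (j i)))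
    ∧ ¬ (∃ c : ∀ i : Fin d, Fin (n i) → ℝ, ∀ j, T j = ∏ i, c i (j i)) := by
  obtain ⟨i₁, i₂, i₃, h₁₂, h₁₃, h₂₃, u, v, w, -, -, -, j₀, hpos⟩ := hhyp2
  refine ⟨?_, fun hc => hpos.ne'
    (IsPureProduct.det222_subTensor222_eq_zero hc h₁₂ h₁₃ h₂₃ u v w j₀)⟩
  have hfibre : ∀ i, finrank ℝ (fibreSpan T i) ≤ 2 := fun i =>
    (finrank_fibreSpan_le_rank T j₀ i).trans <| hflat _ (Finset.singleton_nonempty i) fun h => by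
      have := congrArg Finset.card h
      simp at this
      omega
  have hslice : ∀ i k, finrank ℝ (sliceSpan T i k) ≤ 2 := fun i k =>
    (finrank_sliceSpan_le_rank T j₀ i k).trans <| hflat _ (Finset.insert_nonempty i _) fun h => by
      have := congrArg Finset.card h
      have := Finset.card_le_two (a := i) (b := k)
      simp_all
      omega
  obtain ⟨α₁, β₁, α₂, β₂, α₃, β₃, c₁, c₂, c₃, c₄, c₅, c₆, c₇, c₈⟩ :=
    exists_diagonalizing_of_det222_pos _ hpos
  let pad {m : ℕ} (e : Fin 2 → Fin m) (a : Fin 2 → ℝ) : Fin m → ℝ :=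
    fun x => ∑ p, a p * Pi.single (M := fun _ => ℝ) (e p) 1 x
  have hpad : ∀ {m : ℕ} (e : Fin 2 → Fin m) (a : Fin 2 → ℝ) (h : Fin m → ℝ),
      weightedSum (pad e a) h = ∑ p, a p * h (e p) := by
    intro m e a h
    simp [pad, weightedSum_apply, Pi.single_apply, add_mul, Finset.sum_add_distrib]
  let M : (∀ i : Fin d, Fin (n i)) → Fin (n i₁) × Fin (n i₂) → ℝ :=
    fun c z => T (Function.update (Function.update c i₁ z.1) i₂ z.2)
  have hM : ∀ c, M c ∈ sliceSpan T i₁ i₂ := fun c => Submodule.subset_span ⟨c, rfl⟩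
  let X (γ : Fin 2 → ℝ) : Fin (n i₁) × Fin (n i₂) → ℝ :=
    ∑ r, γ r • M (Function.update j₀ i₃ (w r))
  have hX : ∀ γ, X γ ∈ sliceSpan T i₁ i₂ := fun γ =>
    Submodule.sum_mem _ fun r _ => Submodule.smul_mem _ _ (hM _)
  have hXw : ∀ a b γ, weightedSum₂ (pad u a) (pad v b) (X γ) =
      contract222 (subTensor222 T i₁ i₂ i₃ u v w j₀) a b γ := by
    intro a b γ
    simp only [weightedSum₂_apply, hpad, contract222, subTensor222, X, M, Finset.sum_apply,
      Pi.smul_apply, smul_eq_mul, Function.update_comm h₁₃, Function.update_comm h₂₃]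
  obtain ⟨f₁, g₁, f₂, g₂, e₁, e₂, e₃, e₄, e₅, e₆, e₇, e₈, hdec⟩ :=
    exists_simultaneous_diagonalization M (hfibre i₁) (hfibre i₂) (hslice i₁ i₂) hM
      (fun _ hZ => fibre_left_mem_of_mem_sliceSpan h₁₂ hZ)
      (fun _ hZ => fibre_right_mem_of_mem_sliceSpan hZ) (hX α₃) (hX β₃)
      ((hXw α₁ α₂ α₃).trans c₁) ((hXw α₁ β₂ α₃).trans c₃) ((hXw β₁ α₂ α₃).trans c₄)
      ((hXw β₁ β₂ α₃).trans c₅) ((hXw α₁ α₂ β₃).trans c₆) ((hXw α₁ β₂ β₃).trans c₇)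
      ((hXw β₁ α₂ β₃).trans c₈) ((hXw β₁ β₂ β₃).trans c₂)
  let coef (a b) (c : ∀ i : Fin d, Fin (n i)) : ℝ := weightedSum₂ (pad u a) (pad v b) (M c)
  have hM₁ : ∀ c x, M (Function.update c i₁ x) = M c := fun c x => by simp [M]
  have hM₂ : ∀ c y, M (Function.update c i₂ y) = M c := fun c y => by
    simp [M, Function.update_comm h₁₂]
  have hcoef₁ : ∀ a b c x, coef a b (Function.update c i₁ x) = coef a b c := fun a b c x => by
    simp only [coef, hM₁]
  have hcoef₂ : ∀ a b c y, coef a b (Function.update c i₂ y) = coef a b c := fun a b c y => by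
    simp only [coef, hM₂]
  have hne : ∀ a b γ, contract222 (subTensor222 T i₁ i₂ i₃ u v w j₀) a b γ = 1 →
      ∃ c, coef a b c ≠ 0 := by
    intro a b γ h
    by_contra! h0
    rw [← hXw, map_sum] at h
    simp only [map_smul] at h
    simp only [coef] at h0
    simp [h0] at h
  have hT : ∀ j, T j = coef α₁ α₂ j * (f₁ (j i₁) * f₂ (j i₂)) +
      coef β₁ β₂ j * (g₁ (j i₁) * g₂ (j i₂)) := by
    intro j
    simpa [M] using hdec j (j i₁) (j i₂)
  have hα := isPureProduct_coefficient h₁₂ (fun l _ => hslice i₁ l) (hcoef₁ α₁ α₂) (hcoef₂ α₁ α₂)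
    (hcoef₁ β₁ β₂) (hcoef₂ β₁ β₂) e₁ e₂ e₃ e₄ e₅ e₆ e₇ e₈ hT (hne _ _ _ c₁) (hne _ _ _ c₂)
  have hβ := isPureProduct_coefficient h₁₂ (fun l _ => hslice i₁ l) (hcoef₁ β₁ β₂) (hcoef₂ β₁ β₂)
    (hcoef₁ α₁ α₂) (hcoef₂ α₁ α₂) e₄ e₃ e₂ e₁ e₈ e₇ e₆ e₅ (fun j => (hT j).trans (add_comm _ _))
    (hne _ _ _ c₂) (hne _ _ _ c₁)
  obtain ⟨a, ha⟩ := hα.mul ((IsPureProduct.of_axis i₁ f₁).mul (IsPureProduct.of_axis i₂ f₂))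
  obtain ⟨b, hb⟩ := hβ.mul ((IsPureProduct.of_axis i₁ g₁).mul (IsPureProduct.of_axis i₂ g₂))
  exact ⟨a, b, fun j => by rw [hT, ← ha, ← hb]⟩
end

section
/- Let V be a finite-dimensional real inner product space and C ⊆ V a closed subset satisfying t • x ∈ C for all t ∈ ℝ and x ∈ C, and whose linear span is all of V. For an integer r ≥ 1, let σ_r denote the closure of the set { x₁ + ⋯ + x_r : x₁, …, x_r ∈ C }. Suppose u ∈ V satisfies u ∉ σ_r, and u* ∈ σ_r satisfies ‖u − u*‖ ≤ ‖u − w‖ for all w ∈ σ_r. Then u* ∉ σ_{r−1} (where σ₀ = {0}); that is, a best approximation of u by points of border rank at most r has border rank exactly r. -/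
theorem inner_eq_zero_of_forall_norm_le_norm_sub_smul
    {V : Type*} [NormedAddCommGroup V] [InnerProductSpace ℝ V] {d x : V}
    (h : ∀ t : ℝ, ‖d‖ ≤ ‖d - t • x‖) : inner ℝ d x = 0 := by
  have key : ∀ t : ℝ, 2 * (t * inner ℝ d x) ≤ t ^ 2 * ‖x‖ ^ 2 := by
    intro t
    have h₁ : ‖d‖ ^ 2 ≤ ‖d - t • x‖ ^ 2 := by
      gcongr
      exact h t
    rw [norm_sub_sq_real, inner_smul_right, norm_smul, mul_pow, Real.norm_eq_abs, sq_abs] at h₁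
    linarith
  have h₂ := key (inner ℝ d x / (‖x‖ ^ 2 + 1))
  have hpos : 0 < ‖x‖ ^ 2 + 1 := by positivity
  field_simp at h₂
  nlinarith [sq_nonneg (inner ℝ d x), sq_nonneg ‖x‖,
    mul_nonneg (sq_nonneg (inner ℝ d x)) (sq_nonneg ‖x‖)]

theorem add_mem_closure_sums_succ
    {V : Type*} [AddCommMonoid V] [TopologicalSpace V] [ContinuousAdd V] {C : Set V} {n : ℕ}
    {v x : V} (hv : v ∈ closure {y : V | ∃ f : Fin n → V, (∀ i, f i ∈ C) ∧ y = ∑ i, f i})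
    (hx : x ∈ C) :
    x + v ∈ closure {y : V | ∃ f : Fin (n + 1) → V, (∀ i, f i ∈ C) ∧ y = ∑ i, f i} := by
  refine map_mem_closure (continuous_const_add x) hv ?_
  rintro _ ⟨f, hf, rfl⟩
  exact ⟨Fin.cons x f, Fin.cases hx hf, by simp [Fin.sum_univ_succ]⟩


/-- A best approximation of `u` from the locus of border rank at most `r` of a closed
real cone `C` spanning `V` has border rank exactly `r`, provided `u` itself does not have
border rank at most `r`. -/
theorem best_approximation_has_full_border_rank
    {V : Type*} [NormedAddCommGroup V] [InnerProductSpace ℝ V] [FiniteDimensional ℝ V]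
    (C : Set V) (hC : IsClosed C)
    (hcone : ∀ (t : ℝ), ∀ x ∈ C, t • x ∈ C)
    (hspan : Submodule.span ℝ C = ⊤)
    (r : ℕ) (hr : 1 ≤ r) (u ustar : V)
    (hu : u ∉ closure {x : V | ∃ f : Fin r → V, (∀ i, f i ∈ C) ∧ x = ∑ i, f i})
    (hustar : ustar ∈ closure {x : V | ∃ f : Fin r → V, (∀ i, f i ∈ C) ∧ x = ∑ i, f i})
    (hbest : ∀ w ∈ closure {x : V | ∃ f : Fin r → V, (∀ i, f i ∈ C) ∧ x = ∑ i, f i},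
      ‖u - ustar‖ ≤ ‖u - w‖) :
    ustar ∉ closure {x : V | ∃ f : Fin (r - 1) → V, (∀ i, f i ∈ C) ∧ x = ∑ i, f i} := by
  obtain ⟨n, rfl⟩ := Nat.exists_eq_add_of_le' hr
  intro hmem
  rw [Nat.add_sub_cancel] at hmem
  have horth : ∀ x ∈ C, inner ℝ (u - ustar) x = 0 := fun x hx =>
    inner_eq_zero_of_forall_norm_le_norm_sub_smul fun t => by
      have h := hbest _ (add_mem_closure_sums_succ hmem (hcone t x hx))
      rwa [← sub_sub, sub_right_comm] at h
  have hle : Submodule.span ℝ C ≤ (innerₛₗ ℝ (u - ustar)).ker :=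
    Submodule.span_le.2 horth
  have hzero : inner ℝ (u - ustar) (u - ustar) = 0 :=
    hle (hspan ▸ Submodule.mem_top : u - ustar ∈ Submodule.span ℝ C)
  exact hu (sub_eq_zero.1 (inner_self_eq_zero.1 hzero) ▸ hustar)
end

section
/- Let d ≥ 1 and n : Fin d → ℕ with n i ≥ 1 for all i. Let x and y be families with x i, y i : Fin (n i) → ℝ, and define the real tensor T : (∀ i : Fin d, Fin (n i)) → ℝ by T j = ∑ i, ( y i (j i) * ∏_{k ≠ i} x k (j k) ). Then T lies in the closure of the set of tensors of real rank at most two. (This says that every real point of the tangential variety of the Segre variety lies in the real rank two locus.) -/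
/-- A scalar multiple of a product over a finite type can be absorbed into one chosen factor. -/
lemma prod_ite_one_mul {ι R : Type*} [Fintype ι] [DecidableEq ι] [CommMonoid R]
    (i₀ : ι) (c : R) (f : ι → R) :
    ∏ i, (if i = i₀ then c else 1) * f i = c * ∏ i, f i := by
  rw [Finset.prod_mul_distrib]
  simp

/-- The derivative at `0` of a product of affine functions of one variable. -/
lemma hasDerivAt_prod_add_mul_zero {ι : Type*} [Fintype ι] [DecidableEq ι] (u v : ι → ℝ) :
    HasDerivAt (fun t : ℝ => ∏ i, (u i + t * v i))
      (∑ i, v i * ∏ k ∈ Finset.univ.erase i, u k) 0 := by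
  have h := HasDerivAt.fun_finsetProd (u := Finset.univ) (x := (0 : ℝ))
    (f := fun i t => u i + t * v i) (f' := v)
    fun i _ => by simpa using ((hasDerivAt_id (0 : ℝ)).mul_const (v i)).const_add (u i)
  simpa [mul_comm] using h

/-- Every real point of the tangential variety of the Segre variety lies in the closure of
the set of tensors of real rank at most two. -/
theorem tangential_mem_closure_realRankTwo
    (d : ℕ) (hd : 1 ≤ d) (n : Fin d → ℕ) (hn : ∀ i, 1 ≤ n i)
    (x y : ∀ i : Fin d, Fin (n i) → ℝ)
    (T : (∀ i : Fin d, Fin (n i)) → ℝ)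
    (hT : ∀ j, T j = ∑ i, (y i (j i) * ∏ k ∈ Finset.univ.erase i, x k (j k))) :
    T ∈ closure {S : (∀ i : Fin d, Fin (n i)) → ℝ |
      ∃ a b : ∀ i : Fin d, Fin (n i) → ℝ,
        ∀ j, S j = (∏ i, a i (j i)) + (∏ i, b i (j i))} := by
  let i₀ : Fin d := ⟨0, hd⟩
  have hlim : Filter.Tendsto
      (fun (t : ℝ) (j : ∀ i : Fin d, Fin (n i)) =>
        slope (fun s : ℝ => ∏ i, (x i (j i) + s * y i (j i))) 0 t)
      (nhdsWithin 0 {0}ᶜ) (nhds T) := by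
    refine tendsto_pi_nhds.2 fun j => ?_
    rw [hT]
    exact hasDerivAt_iff_tendsto_slope.1
      (hasDerivAt_prod_add_mul_zero (fun i => x i (j i)) fun i => y i (j i))
  refine mem_closure_of_tendsto hlim (Filter.Eventually.of_forall fun t => ?_)
  refine ⟨fun i m => (if i = i₀ then t⁻¹ else 1) * (x i m + t * y i m),
    fun i m => (if i = i₀ then -t⁻¹ else 1) * x i m, fun j => ?_⟩
  simp only [prod_ite_one_mul, slope_def_field, zero_mul, add_zero, sub_zero]
  ring
end

section
/- Let d ≥ 1 and n : Fin d → ℕ with n i ≥ 1 for all i. Let x and y be families with x i, y i : Fin (n i) → ℝ, and define the real tensor T : (∀ i : Fin d, Fin (n i)) → ℝ by T j = ∑ i, ( y i (j i) * ∏_{k ≠ i} x k (j k) ). Then T lies in the closure of the set of real tensors S for which there exists a family z with z i : Fin (n i) → ℂ such that S j = 2 * Re( ∏ i, z i (j i) ) for all j; that is, T is a limit of real tensors that are sums of a complex rank one tensor and its complex conjugate. -/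
/-- The imaginary part of `t ↦ ∏ i, (a i + t b i I)` has derivative
`∑ i, b i * ∏ k ≠ i, a k` at the origin. -/
theorem hasDerivAt_im_prod_add_mul_I {ι : Type*} [Fintype ι] [DecidableEq ι] (a b : ι → ℝ) :
    HasDerivAt (fun t : ℝ => (∏ i, ((a i : ℂ) + t * (b i * Complex.I))).im)
      (∑ i, b i * ∏ k ∈ Finset.univ.erase i, a k) 0 := by
  have hfactor (i : ι) : HasDerivAt (fun t : ℝ => (a i : ℂ) + t * (b i * Complex.I))
      (b i * Complex.I) 0 := by
    simpa using ((Complex.ofRealCLM.hasDerivAt (x := 0)).mul_const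
      ((b i : ℂ) * Complex.I)).const_add (a i : ℂ)
  have hprod := HasDerivAt.fun_finsetProd (u := Finset.univ) fun i _ => hfactor i
  refine (Complex.imCLM.hasFDerivAt.comp_hasDerivAt (0 : ℝ) hprod).congr_deriv ?_
  simp only [Complex.imCLM_apply, Complex.im_sum, Complex.ofReal_zero, zero_mul, add_zero,
    smul_eq_mul]
  refine Finset.sum_congr rfl fun i _ => ?_
  rw [← Complex.ofReal_prod, Complex.im_ofReal_mul, Complex.im_ofReal_mul, Complex.I_im, mul_one,
    mul_comm]


/-- Every real point of the tangential variety of the Segre variety is a limit of real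
tensors that are sums of a complex rank one tensor and its complex conjugate. -/
theorem tangential_mem_closure_conjugatePairs
    (d : ℕ) (hd : 1 ≤ d) (n : Fin d → ℕ) (hn : ∀ i, 1 ≤ n i)
    (x y : ∀ i : Fin d, Fin (n i) → ℝ)
    (T : (∀ i : Fin d, Fin (n i)) → ℝ)
    (hT : ∀ j, T j = ∑ i, (y i (j i) * ∏ k ∈ Finset.univ.erase i, x k (j k))) :
    T ∈ closure {S : (∀ i : Fin d, Fin (n i)) → ℝ |
      ∃ z : ∀ i : Fin d, Fin (n i) → ℂ,
        ∀ j, S j = 2 * (∏ i, z i (j i)).re} := by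
  let P (t : ℝ) (j : ∀ i : Fin d, Fin (n i)) : ℂ :=
    ∏ i, ((x i (j i) : ℂ) + t * (y i (j i) * Complex.I))
  have hlim : Filter.Tendsto (fun (t : ℝ) j => t⁻¹ * (P t j).im)
      (nhdsWithin 0 {0}ᶜ) (nhds T) := by
    refine tendsto_pi_nhds.2 fun j => ?_
    rw [hT j]
    have hslope := (hasDerivAt_im_prod_add_mul_I (fun i => x i (j i))
      (fun i => y i (j i))).tendsto_slope_zero
    simpa [P, ← Complex.ofReal_prod] using hslope
  refine mem_closure_of_tendsto hlim (Filter.Eventually.of_forall fun t => ?_)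
  let c : ℂ := ((2 * t)⁻¹ : ℝ) * -Complex.I
  refine ⟨fun i m => (Pi.mulSingle (⟨0, hd⟩ : Fin d) c : Fin d → ℂ) i *
    ((x i m : ℂ) + t * (y i m * Complex.I)), fun j => ?_⟩
  rw [Finset.prod_mul_distrib, Fintype.prod_pi_mulSingle']
  change t⁻¹ * (P t j).im = 2 * (c * P t j).re
  rw [mul_assoc, Complex.re_ofReal_mul, mul_inv]
  simp
  ring
end

section
/- Let d ≥ 3 and let x : Fin (d+1) → ℝ. Then x lies in the real rank two cone R_d of binary forms of degree d if and only if every 3×3 minor of the Hankel matrix H(x) vanishes and, for every i with 0 ≤ i ≤ d−3, the quartic inequality x_i² x_{i+3}² − 6 x_i x_{i+1} x_{i+2} x_{i+3} − 3 x_{i+1}² x_{i+2}² + 4 x_{i+1}³ x_{i+3} + 4 x_i x_{i+2}³ ≥ 0 holds. -/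
/-- The 3×(d−1) Hankel matrix of the coefficient vector of a binary form of degree `d`. -/
def hankel (d : ℕ) (x : Fin (d + 1) → ℝ) : Matrix (Fin 3) (Fin (d - 1)) ℝ :=
  fun p q => x ⟨p.1 + q.1, by omega⟩

/-- The real binary forms of degree `d` that are combinations of two `d`-th powers. -/
def twoPowerForms (d : ℕ) : Set (Fin (d + 1) → ℝ) :=
  {v | ∃ l m a b c e : ℝ, ∀ i : Fin (d + 1),
    v i = l * a ^ (d - (i : ℕ)) * b ^ (i : ℕ) + m * c ^ (d - (i : ℕ)) * e ^ (i : ℕ)}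

/-- The hyperdeterminant of the binary cubic with coefficient vector `(x₀, x₁, x₂, x₃)`. -/
def cubicHyperdet (x₀ x₁ x₂ x₃ : ℝ) : ℝ :=
  x₀ ^ 2 * x₃ ^ 2 - 6 * x₀ * x₁ * x₂ * x₃ - 3 * x₁ ^ 2 * x₂ ^ 2 + 4 * x₁ ^ 3 * x₃ + 4 * x₀ * x₂ ^ 3

/-- The sequence with initial values `u`, `v` and characteristic roots `r`, `s`. -/
noncomputable def recSeq (u v r s : ℝ) : ℕ → ℝ
  | 0 => u
  | 1 => v
  | n + 2 => (r + s) * recSeq u v r s (n + 1) - r * s * recSeq u v r s n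

theorem continuous_recSeq (u v r : ℝ) (n : ℕ) : Continuous fun s => recSeq u v r s n := by
  induction n using Nat.twoStepInduction with
  | zero => simpa only [recSeq] using continuous_const
  | one => simpa only [recSeq] using continuous_const
  | more n ih₀ ih₁ => simp only [recSeq]; fun_prop

theorem recSeq_eq_of_ne (u v : ℝ) {r s : ℝ} (h : s ≠ r) (n : ℕ) :
    recSeq u v r s n = (v - s * u) / (r - s) * r ^ n + (r * u - v) / (r - s) * s ^ n := by
  have h' : r - s ≠ 0 := sub_ne_zero.2 h.symm
  induction n using Nat.twoStepInduction with
  | zero => simp only [recSeq]; field_simp; ring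
  | one => simp only [recSeq]; field_simp; ring
  | more n ih₀ ih₁ => simp only [recSeq, ih₀, ih₁]; ring

theorem recSeq_mem_closure (d : ℕ) (u v r s : ℝ) :
    (fun i : Fin (d + 1) => recSeq u v r s i) ∈ closure (twoPowerForms d) := by
  have hcont : Continuous fun s => fun i : Fin (d + 1) => recSeq u v r s i :=
    continuous_pi fun i => continuous_recSeq u v r i
  have hs : s ∈ closure ({r}ᶜ : Set ℝ) := (dense_compl_singleton r) s
  refine map_mem_closure hcont hs fun s' hs' => ?_
  exact ⟨(v - s' * u) / (r - s'), (r * u - v) / (r - s'), 1, r, 1, s', fun i => by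
    simp [recSeq_eq_of_ne u v (Set.mem_compl_singleton_iff.1 hs')]⟩

theorem rev_mem_twoPowerForms {d : ℕ} {v : Fin (d + 1) → ℝ} (hv : v ∈ twoPowerForms d) :
    (fun i => v i.rev) ∈ twoPowerForms d := by
  obtain ⟨l, m, a, b, c, e, h⟩ := hv
  refine ⟨l, m, b, a, e, c, fun i => ?_⟩
  have h₁ : ((i.rev : Fin (d + 1)) : ℕ) = d - i := by rw [Fin.val_rev]; omega
  have h₂ : d - (d - (i : ℕ)) = i := by omega
  simp only [h, h₁, h₂]
  ring

theorem rev_mem_closure {d : ℕ} {v : Fin (d + 1) → ℝ} (hv : v ∈ closure (twoPowerForms d)) :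
    (fun i => v i.rev) ∈ closure (twoPowerForms d) :=
  map_mem_closure (f := fun (w : Fin (d + 1) → ℝ) (i : Fin (d + 1)) => w i.rev) 
    (continuous_pi fun i => continuous_apply i.rev) hv fun _ => rev_mem_twoPowerForms

/-- A form annihilated by a quadric with leading coefficient nonzero and real roots is a limit of
combinations of two powers. -/
theorem mem_closure_of_recurrence {d : ℕ} (hd : 1 ≤ d) (x : Fin (d + 1) → ℝ) {p q r : ℝ}
    (hr : r ≠ 0) (hD : 0 ≤ q ^ 2 - 4 * p * r)
    (h : ∀ j : ℕ, ∀ hj : j + 2 ≤ d,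
      p * x ⟨j, by omega⟩ + q * x ⟨j + 1, by omega⟩ + r * x ⟨j + 2, by omega⟩ = 0) :
    x ∈ closure (twoPowerForms d) := by
  set w := √(q ^ 2 - 4 * p * r) with hw
  have hww : w ^ 2 = q ^ 2 - 4 * p * r := Real.sq_sqrt hD
  set α := (-q + w) / (2 * r) with hα
  set β := (-q - w) / (2 * r) with hβ
  have hsum : r * (α + β) = -q := by rw [hα, hβ]; field_simp; ring
  have hprod : r * (α * β) = p := by
    rw [hα, hβ]; field_simp; linear_combination -hww
  have key : ∀ n : ℕ, ∀ hn : n < d + 1,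
      x ⟨n, hn⟩ = recSeq (x ⟨0, by omega⟩) (x ⟨1, by omega⟩) α β n := by
    intro n
    induction n using Nat.twoStepInduction with
    | zero => intro _; rfl
    | one => intro _; rfl
    | more n ih₀ ih₁ =>
      intro hn
      simp only [recSeq]
      rw [← ih₀ (by omega), ← ih₁ (by omega)]
      apply mul_left_cancel₀ hr
      linear_combination h n (by omega) - x ⟨n + 1, by omega⟩ * hsum + x ⟨n, by omega⟩ * hprod
  have hx : x = fun i : Fin (d + 1) => recSeq (x ⟨0, by omega⟩) (x ⟨1, by omega⟩) α β i :=
    funext fun i => key i i.2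
  rw [hx]
  exact recSeq_mem_closure _ _ _ _ _

theorem mem_closure_of_annihilator {d : ℕ} (hd : 1 ≤ d) (x : Fin (d + 1) → ℝ) {p q r : ℝ}
    (hne : p ≠ 0 ∨ q ≠ 0 ∨ r ≠ 0) (hD : 0 ≤ q ^ 2 - 4 * p * r)
    (h : ∀ j : ℕ, ∀ hj : j + 2 ≤ d,
      p * x ⟨j, by omega⟩ + q * x ⟨j + 1, by omega⟩ + r * x ⟨j + 2, by omega⟩ = 0) :
    x ∈ closure (twoPowerForms d) := by
  by_cases hr : r = 0
  · by_cases hp : p = 0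
    · subst hr hp
      have hq : q ≠ 0 := by simpa using hne
      refine subset_closure ⟨x ⟨0, by omega⟩, x ⟨d, by omega⟩, 1, 0, 0, 1, ?_⟩
      rintro ⟨i, hi⟩
      rcases Nat.eq_zero_or_pos i with rfl | hi₀
      · have : d ≠ 0 := by omega
        simp [this]
      · rcases Nat.lt_or_ge i d with hid | hid
        · have := h (i - 1) (by omega)
          have hi' : i - 1 + 1 = i := by omega
          simp only [hi', zero_mul, zero_add, add_zero, mul_eq_zero, hq, false_or] at this
          have h₁ : d - i ≠ 0 := by omega
          have h₂ : i ≠ 0 := by omega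
          simp [this, h₁, h₂]
        · obtain rfl : i = d := by omega
          have : i ≠ 0 := by omega
          simp [this]
    · have := rev_mem_closure (mem_closure_of_recurrence hd (fun i => x i.rev) (p := r) (q := q)
        (r := p) hp (by linarith) fun j hj => ?_)
      · simpa using this
      · have h₀ := h (d - 2 - j) (by omega)
        have e₀ : Fin.rev (⟨j, by omega⟩ : Fin (d + 1)) = ⟨d - 2 - j + 2, by omega⟩ := by
          ext; simp only [Fin.val_rev]; omega
        have e₁ : Fin.rev (⟨j + 1, by omega⟩ : Fin (d + 1)) = ⟨d - 2 - j + 1, by omega⟩ := by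
          ext; simp only [Fin.val_rev]; omega
        have e₂ : Fin.rev (⟨j + 2, by omega⟩ : Fin (d + 1)) = ⟨d - 2 - j, by omega⟩ := by
          ext; simp only [Fin.val_rev]; omega
        simp only [e₀, e₁, e₂]
        linarith
  · exact mem_closure_of_recurrence hd x hr hD h

/-- A cubic with nonnegative hyperdeterminant annihilated by a definite quadric vanishes. -/
theorem eq_zero_of_definite_annihilator {p q r x₀ x₁ x₂ x₃ : ℝ} (hD : q ^ 2 - 4 * p * r < 0)
    (h₀ : p * x₀ + q * x₁ + r * x₂ = 0) (h₁ : p * x₁ + q * x₂ + r * x₃ = 0)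
    (hx : 0 ≤ cubicHyperdet x₀ x₁ x₂ x₃) : x₀ = 0 ∧ x₁ = 0 := by
  have hr : r ≠ 0 := by rintro rfl; nlinarith [sq_nonneg q]
  obtain rfl : x₂ = -(p * x₀ + q * x₁) / r := by field_simp; linarith
  obtain rfl : x₃ = -(p * x₁ + q * (-(p * x₀ + q * x₁) / r)) / r := by
    field_simp at h₁ ⊢; linarith
  set F := p * x₀ ^ 2 + q * x₀ * x₁ + r * x₁ ^ 2 with hF
  have hdisc : r ^ 4 * cubicHyperdet x₀ x₁ (-(p * x₀ + q * x₁) / r)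
      (-(p * x₁ + q * (-(p * x₀ + q * x₁) / r)) / r) = F ^ 2 * (q ^ 2 - 4 * p * r) := by
    rw [hF, cubicHyperdet]; field_simp; ring
  have hnn : 0 ≤ F ^ 2 * (q ^ 2 - 4 * p * r) := hdisc ▸ mul_nonneg (by positivity) hx
  have hF0 : F = 0 := by
    by_contra hne
    exact absurd (mul_neg_of_pos_of_neg (by positivity : 0 < F ^ 2) hD) (not_lt.2 hnn)
  have hsq : (2 * r * x₁ + q * x₀) ^ 2 + (4 * p * r - q ^ 2) * x₀ ^ 2 = 0 := by
    linear_combination 4 * r * hF0 - 4 * r * hF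
  have hx₀ : x₀ = 0 := by
    by_contra hne
    have : 0 < (4 * p * r - q ^ 2) * x₀ ^ 2 := mul_pos (by linarith) (by positivity)
    nlinarith [sq_nonneg (2 * r * x₁ + q * x₀)]
  refine ⟨hx₀, ?_⟩
  rw [hx₀] at hsq
  have : (2 * r * x₁) ^ 2 = 0 := by linarith
  simpa [hr] using this

/-- If all maximal minors of a `3 × n` matrix vanish, its rows are linearly dependent. -/
theorem exists_left_kernel_of_minors_eq_zero {n : ℕ} (A : Matrix (Fin 3) (Fin n) ℝ)
    (hA : ∀ cols : Fin 3 → Fin n, (A.submatrix id cols).det = 0) :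
    ∃ p q r : ℝ, (p ≠ 0 ∨ q ≠ 0 ∨ r ≠ 0) ∧ ∀ j, p * A 0 j + q * A 1 j + r * A 2 j = 0 := by
  have hW : Submodule.span ℝ (Set.range A.col) < ⊤ := by
    rw [lt_top_iff_ne_top]
    intro htop
    obtain ⟨f, hf, -, hli⟩ := Submodule.exists_fun_fin_finrank_span_eq ℝ (Set.range A.col)
    have hfin : Module.finrank ℝ (Submodule.span ℝ (Set.range A.col)) = 3 := by
      rw [htop]; simp
    have hli' : LinearIndependent ℝ (f ∘ Fin.cast hfin.symm) :=
      hli.comp _ (Fin.cast_injective _)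
    choose g hg using hf
    have hcols : (A.submatrix id (g ∘ Fin.cast hfin.symm)).col = f ∘ Fin.cast hfin.symm := by
      funext i
      simp only [Function.comp_apply, ← hg]
      rfl
    rw [← hcols, Matrix.linearIndependent_cols_iff_isUnit, Matrix.isUnit_iff_isUnit_det,
      hA] at hli'
    exact not_isUnit_zero hli'
  obtain ⟨φ, hφ, hle⟩ := Submodule.exists_le_ker_of_lt_top _ hW
  have hexp : ∀ v : Fin 3 → ℝ, φ v = φ (Pi.single 0 1) * v 0 + φ (Pi.single 1 1) * v 1
      + φ (Pi.single 2 1) * v 2 := by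
    intro v
    have hv : v = v 0 • Pi.single 0 1 + v 1 • Pi.single 1 1 + v 2 • Pi.single 2 1 := by
      ext i
      fin_cases i <;> simp
    conv_lhs => rw [hv]
    simp only [map_add, map_smul, smul_eq_mul, mul_comm]
  refine ⟨φ (Pi.single 0 1), φ (Pi.single 1 1), φ (Pi.single 2 1), ?_, fun j => ?_⟩
  · by_contra! hz
    exact hφ (LinearMap.ext fun v => by rw [hexp, hz.1, hz.2.1, hz.2.2]; simp)
  · have := hle (Submodule.subset_span ⟨j, rfl⟩)
    rw [LinearMap.mem_ker, hexp] at this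
    exact this

theorem hankel_minor_eq_zero_of_mem {d : ℕ} {v : Fin (d + 1) → ℝ} (hv : v ∈ twoPowerForms d)
    (cols : Fin 3 → Fin (d - 1)) : ((hankel d v).submatrix id cols).det = 0 := by
  obtain ⟨l, m, a, b, c, e, h⟩ := hv
  have key : ∀ (k : Fin 3) (p : Fin 3), hankel d v p (cols k) =
      (l * a ^ (d - 2 - (cols k : ℕ)) * b ^ (cols k : ℕ)) * (a ^ (2 - (p : ℕ)) * b ^ (p : ℕ)) +
      (m * c ^ (d - 2 - (cols k : ℕ)) * e ^ (cols k : ℕ)) * (c ^ (2 - (p : ℕ)) * e ^ (p : ℕ)) := by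
    intro k p
    have : d - ((p : ℕ) + (cols k : ℕ)) = (d - 2 - (cols k : ℕ)) + (2 - (p : ℕ)) := by
      have := (cols k).2; have := p.2; omega
    simp only [hankel, h, this, pow_add]
    ring
  rw [Matrix.det_fin_three]
  simp only [Matrix.submatrix_apply, id_eq, key]
  norm_num
  ring

theorem cubicHyperdet_nonneg_of_mem {d : ℕ} {v : Fin (d + 1) → ℝ} (hv : v ∈ twoPowerForms d)
    (i : ℕ) (hi : i + 3 ≤ d) :
    0 ≤ cubicHyperdet (v ⟨i, by omega⟩) (v ⟨i + 1, by omega⟩) (v ⟨i + 2, by omega⟩)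
      (v ⟨i + 3, by omega⟩) := by
  obtain ⟨l, m, a, b, c, e, h⟩ := hv
  obtain ⟨k, rfl⟩ := Nat.exists_eq_add_of_le hi
  have e₀ : i + 3 + k - i = k + 3 := by omega
  have e₁ : i + 3 + k - (i + 1) = k + 2 := by omega
  have e₂ : i + 3 + k - (i + 2) = k + 1 := by omega
  have e₃ : i + 3 + k - (i + 3) = k := by omega
  simp only [cubicHyperdet, h, e₀, e₁, e₂, e₃]
  have : 0 ≤ ((l * a ^ k * b ^ i) * (m * c ^ k * e ^ i) * (a * e - b * c) ^ 3) ^ 2 := sq_nonneg _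
  convert this using 1
  simp only [pow_add]
  generalize a ^ k = A
  generalize b ^ i = B
  generalize c ^ k = C
  generalize e ^ i = E
  ring

/-- A binary form of degree `d ≥ 3` lies in the real rank two cone if and only if all
3×3 minors of its Hankel matrix vanish and the `d−2` symmetric hyperdeterminant quartic
inequalities hold. -/
theorem realRankTwo_binaryForms_iff
    (d : ℕ) (hd : 3 ≤ d) (x : Fin (d + 1) → ℝ) :
    x ∈ closure {v : Fin (d + 1) → ℝ |
        ∃ l m a b c e : ℝ, ∀ i : Fin (d + 1),
          v i = l * a ^ (d - (i : ℕ)) * b ^ (i : ℕ) + m * c ^ (d - (i : ℕ)) * e ^ (i : ℕ)}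
    ↔ ((∀ cols : Fin 3 → Fin (d - 1), ((hankel d x).submatrix id cols).det = 0)
      ∧ (∀ i : ℕ, ∀ hi : i ≤ d - 3,
          0 ≤ (x ⟨i, by omega⟩)^2 * (x ⟨i+3, by omega⟩)^2
            - 6 * x ⟨i, by omega⟩ * x ⟨i+1, by omega⟩ * x ⟨i+2, by omega⟩ * x ⟨i+3, by omega⟩
            - 3 * (x ⟨i+1, by omega⟩)^2 * (x ⟨i+2, by omega⟩)^2
            + 4 * (x ⟨i+1, by omega⟩)^3 * x ⟨i+3, by omega⟩
            + 4 * x ⟨i, by omega⟩ * (x ⟨i+2, by omega⟩)^3)) := by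
  change x ∈ closure (twoPowerForms d) ↔ _
  constructor
  · intro hx
    refine ⟨fun cols => ?_, fun i hi => ?_⟩
    · have hcont : Continuous fun v : Fin (d + 1) → ℝ =>
          ((hankel d v).submatrix id cols).det := by
        refine Continuous.matrix_det (continuous_matrix fun p q => ?_)
        exact continuous_apply _
      exact closure_minimal (fun v hv => hankel_minor_eq_zero_of_mem hv cols)
        (isClosed_eq hcont continuous_const) hx
    · have hcont : Continuous fun v : Fin (d + 1) → ℝ => cubicHyperdet (v ⟨i, by omega⟩)
          (v ⟨i + 1, by omega⟩) (v ⟨i + 2, by omega⟩) (v ⟨i + 3, by omega⟩) := by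
        unfold cubicHyperdet
        fun_prop
      exact closure_minimal (fun v hv => cubicHyperdet_nonneg_of_mem hv i (by omega))
        (isClosed_le continuous_const hcont) hx
  · rintro ⟨hminor, hquartic⟩
    obtain ⟨p, q, r, hne, hker⟩ := exists_left_kernel_of_minors_eq_zero _ hminor
    have hrec : ∀ j : ℕ, ∀ hj : j + 2 ≤ d,
        p * x ⟨j, by omega⟩ + q * x ⟨j + 1, by omega⟩ + r * x ⟨j + 2, by omega⟩ = 0 := by
      intro j hj
      have := hker ⟨j, by omega⟩
      have hrow : ∀ k : Fin 3, hankel d x k ⟨j, by omega⟩ = x ⟨j + k, by omega⟩ :=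
        fun k => congrArg x (Fin.ext (Nat.add_comm _ _))
      rw [hrow, hrow, hrow] at this
      exact this
    by_cases hD : 0 ≤ q ^ 2 - 4 * p * r
    · exact mem_closure_of_annihilator (by omega) x hne hD hrec
    · rw [not_le] at hD
      obtain ⟨hx₀, hx₁⟩ := eq_zero_of_definite_annihilator hD (hrec 0 (by omega))
        (hrec 1 (by omega)) (hquartic 0 (by omega))
      have hr : r ≠ 0 := by rintro rfl; nlinarith [sq_nonneg q]
      have hzero : ∀ n : ℕ, ∀ hn : n < d + 1, x ⟨n, hn⟩ = 0 := by
        intro n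
        induction n using Nat.twoStepInduction with
        | zero => exact fun _ => hx₀
        | one => exact fun _ => hx₁
        | more n ih₀ ih₁ =>
          intro hn
          have := hrec n (by omega)
          rw [ih₀, ih₁] at this
          simpa [hr] using this
      exact subset_closure ⟨0, 0, 0, 0, 0, 0, fun i => by simpa using hzero i i.2⟩
end

section
/- Let x : Fin 6 → ℝ and set Q₀ = 3x₂² − 4x₁x₃ + x₀x₄, Q₁ = 2x₂x₃ − 3x₁x₄ + x₀x₅, Q₂ = 3x₃² − 4x₂x₄ + x₁x₅. Then x lies in the real rank two cone R₅ of binary quintics if and only if every 3×3 minor of the 3×4 Hankel matrix H(x) vanishes and Q₁² − 4 Q₀ Q₂ ≥ 0. -/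
/-- The 3×4 Hankel matrix of the coefficient vector of a binary quintic. -/
def hankel5 (x : Fin 6 → ℝ) : Matrix (Fin 3) (Fin 4) ℝ :=
  fun p q => x ⟨p.1 + q.1, by omega⟩

open Filter Topology in
/-- The value at `0` of a continuous curve lies in the closure of every set that contains the
curve at positive times. -/
lemma mem_closure_of_continuous_curve {X : Type*} [TopologicalSpace X] {S : Set X} {y : ℝ → X}
    (hy : Continuous y) (hS : ∀ ε, 0 < ε → y ε ∈ S) : y 0 ∈ closure S :=
  mem_closure_of_tendsto ((hy.tendsto 0).mono_left (nhdsWithin_le_nhds (s := Set.Ioi 0)))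
    (eventually_mem_nhdsWithin.mono fun ε hε => hS ε hε)

/-- The binary quintics that are real linear combinations of two fifth powers of real linear
forms. -/
def sumsOfTwoFifthPowers : Set (Fin 6 → ℝ) :=
  {v | ∃ l m a b c e : ℝ, ∀ i : Fin 6,
    v i = l * a ^ (5 - (i : ℕ)) * b ^ (i : ℕ) + m * c ^ (5 - (i : ℕ)) * e ^ (i : ℕ)}

/-- The discriminant of the pencil of quadrics `Q₀, Q₁, Q₂`. -/
def quadricsDiscrim (x : Fin 6 → ℝ) : ℝ :=
  (2 * x 2 * x 3 - 3 * x 1 * x 4 + x 0 * x 5) ^ 2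
    - 4 * (3 * (x 2) ^ 2 - 4 * x 1 * x 3 + x 0 * x 4)
      * (3 * (x 3) ^ 2 - 4 * x 2 * x 4 + x 1 * x 5)

/-- The coefficients of a sum of two fifth powers, one coordinate at a time. -/
lemma mem_sumsOfTwoFifthPowers {v : Fin 6 → ℝ} :
    v ∈ sumsOfTwoFifthPowers ↔ ∃ l m a b c e : ℝ,
      v 0 = l * a ^ 5 + m * c ^ 5 ∧ v 1 = l * a ^ 4 * b + m * c ^ 4 * e ∧
      v 2 = l * a ^ 3 * b ^ 2 + m * c ^ 3 * e ^ 2 ∧ v 3 = l * a ^ 2 * b ^ 3 + m * c ^ 2 * e ^ 3 ∧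
      v 4 = l * a * b ^ 4 + m * c * e ^ 4 ∧ v 5 = l * b ^ 5 + m * e ^ 5 := by
  simp [sumsOfTwoFifthPowers, Fin.forall_fin_succ]

/-- The discriminant of the quadrics is nonnegative on sums of two fifth powers. -/
lemma quadricsDiscrim_nonneg {v : Fin 6 → ℝ} (hv : v ∈ sumsOfTwoFifthPowers) :
    0 ≤ quadricsDiscrim v := by
  obtain ⟨l, m, a, b, c, e, h0, h1, h2, h3, h4, h5⟩ := mem_sumsOfTwoFifthPowers.1 hv
  have : quadricsDiscrim v = (l * m * (a * e - b * c) ^ 5) ^ 2 := by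
    rw [quadricsDiscrim, h0, h1, h2, h3, h4, h5]; ring
  rw [this]; positivity

/-- The maximal minors of the Hankel matrix vanish on sums of two fifth powers. -/
lemma hankel5_det_eq_zero {v : Fin 6 → ℝ} (hv : v ∈ sumsOfTwoFifthPowers)
    (cols : Fin 3 → Fin 4) : ((hankel5 v).submatrix id cols).det = 0 := by
  obtain ⟨l, m, a, b, c, e, h0, h1, h2, h3, h4, h5⟩ := mem_sumsOfTwoFifthPowers.1 hv
  have entry (i : Fin 3) (j : Fin 4) : hankel5 v i j =
      l * a ^ (2 - (i : ℕ)) * b ^ (i : ℕ) * (a ^ (3 - (j : ℕ)) * b ^ (j : ℕ)) +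
        m * c ^ (2 - (i : ℕ)) * e ^ (i : ℕ) * (c ^ (3 - (j : ℕ)) * e ^ (j : ℕ)) := by
    fin_cases i <;> fin_cases j <;> simp [hankel5, h0, h1, h2, h3, h4, h5] <;> ring
  simp only [Matrix.det_fin_three, Matrix.submatrix_apply, id_eq, entry]
  generalize a ^ (3 - (cols 0 : ℕ)) * b ^ (cols 0 : ℕ) = f0
  generalize a ^ (3 - (cols 1 : ℕ)) * b ^ (cols 1 : ℕ) = f1
  generalize a ^ (3 - (cols 2 : ℕ)) * b ^ (cols 2 : ℕ) = f2
  generalize c ^ (3 - (cols 0 : ℕ)) * e ^ (cols 0 : ℕ) = g0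
  generalize c ^ (3 - (cols 1 : ℕ)) * e ^ (cols 1 : ℕ) = g1
  generalize c ^ (3 - (cols 2 : ℕ)) * e ^ (cols 2 : ℕ) = g2
  ring

/-- The Cauchy–Binet formula for the Gram determinant of a 3×4 matrix. -/
lemma det_mul_transpose_three_four (M : Matrix (Fin 3) (Fin 4) ℝ) :
    (M * M.transpose).det = (M.submatrix id ![0, 1, 2]).det ^ 2 +
      (M.submatrix id ![0, 1, 3]).det ^ 2 + (M.submatrix id ![0, 2, 3]).det ^ 2 +
      (M.submatrix id ![1, 2, 3]).det ^ 2 := by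
  simp [Matrix.det_fin_three, Matrix.mul_apply, Fin.sum_univ_four]
  ring

/-- If all maximal minors of the Hankel matrix vanish, the coefficients satisfy a nontrivial
linear recurrence of order two. -/
lemma exists_recurrence {x : Fin 6 → ℝ}
    (h : ∀ cols : Fin 3 → Fin 4, ((hankel5 x).submatrix id cols).det = 0) :
    ∃ u : Fin 3 → ℝ, u ≠ 0 ∧ u 0 * x 0 + u 1 * x 1 + u 2 * x 2 = 0 ∧
      u 0 * x 1 + u 1 * x 2 + u 2 * x 3 = 0 ∧ u 0 * x 2 + u 1 * x 3 + u 2 * x 4 = 0 ∧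
      u 0 * x 3 + u 1 * x 4 + u 2 * x 5 = 0 := by
  have key : (hankel5 x * (hankel5 x).transpose).det = 0 := by
    simp [det_mul_transpose_three_four, h]
  obtain ⟨u, hu, hk⟩ := Matrix.exists_vecMul_eq_zero_iff.2 key
  rw [← Matrix.conjTranspose_eq_transpose_of_trivial,
    Matrix.vecMul_self_mul_conjTranspose_eq_zero] at hk
  have e0 := congrFun hk 0
  have e1 := congrFun hk 1
  have e2 := congrFun hk 2
  have e3 := congrFun hk 3
  simp [Matrix.vecMul, dotProduct, Fin.sum_univ_three, hankel5] at e0 e1 e2 e3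
  exact ⟨u, hu, e0, e1, e2, e3⟩

/-- The solutions of a linear recurrence of order two with distinct real characteristic roots
are sums of two fifth powers. -/
lemma mem_sumsOfTwoFifthPowers_of_recurrence {x : Fin 6 → ℝ} {p q : ℝ} (hD : 0 < p ^ 2 + 4 * q)
    (h2 : x 2 = p * x 1 + q * x 0) (h3 : x 3 = p * x 2 + q * x 1) (h4 : x 4 = p * x 3 + q * x 2)
    (h5 : x 5 = p * x 4 + q * x 3) : x ∈ sumsOfTwoFifthPowers := by
  obtain ⟨s, hs, hs2⟩ : ∃ s : ℝ, s ≠ 0 ∧ s ^ 2 = p ^ 2 + 4 * q :=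
    ⟨√(p ^ 2 + 4 * q), (Real.sqrt_pos.2 hD).ne', Real.sq_sqrt hD.le⟩
  obtain ⟨a, c, rfl, rfl, hac⟩ : ∃ a c : ℝ, p = a + c ∧ q = -(a * c) ∧ a - c ≠ 0 :=
    ⟨(p + s) / 2, (p - s) / 2, by ring, by linarith, by ring_nf; exact hs⟩
  refine mem_sumsOfTwoFifthPowers.2
    ⟨(x 1 - c * x 0) / (a - c), (a * x 0 - x 1) / (a - c), 1, a, 1, c, ?_⟩
  rw [h5, h4, h3, h2]
  refine ⟨?_, ?_, ?_, ?_, ?_, ?_⟩ <;> field_simp <;> ring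

/-- The solutions of a linear recurrence of order two whose characteristic roots are real lie in
the closure of the sums of two fifth powers. -/
lemma mem_closure_of_recurrence_s10 {x : Fin 6 → ℝ} {p q : ℝ} (hD : 0 ≤ p ^ 2 + 4 * q)
    (h2 : x 2 = p * x 1 + q * x 0) (h3 : x 3 = p * x 2 + q * x 1) (h4 : x 4 = p * x 3 + q * x 2)
    (h5 : x 5 = p * x 4 + q * x 3) : x ∈ closure sumsOfTwoFifthPowers := by
  let y2 : ℝ → ℝ := fun ε => p * x 1 + (q + ε) * x 0
  let y3 : ℝ → ℝ := fun ε => p * y2 ε + (q + ε) * x 1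
  let y4 : ℝ → ℝ := fun ε => p * y3 ε + (q + ε) * y2 ε
  let y5 : ℝ → ℝ := fun ε => p * y4 ε + (q + ε) * y3 ε
  have hx : x = ![x 0, x 1, y2 0, y3 0, y4 0, y5 0] := by
    ext i
    fin_cases i <;> simp [y2, y3, y4, y5, h5, h4, h3, h2]
  rw [hx]
  refine mem_closure_of_continuous_curve
    (y := fun ε => ![x 0, x 1, y2 ε, y3 ε, y4 ε, y5 ε]) ?_ fun ε hε => ?_
  · refine continuous_pi fun i => ?_
    fin_cases i <;> simp [y2, y3, y4, y5] <;> fun_prop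
  · exact mem_sumsOfTwoFifthPowers_of_recurrence (p := p) (q := q + ε) (by linarith)
      rfl rfl rfl rfl

/-- Quintics of the form `t ^ 4 * (linear form)` lie in the closure of the sums of two fifth
powers. -/
lemma mem_closure_of_coeff_eq_zero {x : Fin 6 → ℝ} (h0 : x 0 = 0) (h1 : x 1 = 0) (h2 : x 2 = 0)
    (h3 : x 3 = 0) : x ∈ closure sumsOfTwoFifthPowers := by
  have hx : x = ![0 ^ 2 * x 4, 0 ^ 2 * x 5, 0 * x 4, 0 * x 5, x 4, x 5] := by
    ext i
    fin_cases i <;> simp [h0, h1, h2, h3]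
  rw [hx]
  refine mem_closure_of_continuous_curve
    (y := fun ε => ![ε ^ 2 * x 4, ε ^ 2 * x 5, ε * x 4, ε * x 5, x 4, x 5]) ?_ fun ε hε => ?_
  · refine continuous_pi fun i => ?_
    fin_cases i <;> simp <;> fun_prop
  · refine mem_sumsOfTwoFifthPowers_of_recurrence (p := 0) (q := 1 / ε) (by positivity)
      ?_ ?_ ?_ ?_ <;> simp <;> field_simp

/-- A solution of a linear recurrence of order two with nonreal characteristic roots at which the
discriminant of the quadrics is nonnegative is zero. -/
lemma eq_zero_of_recurrence {x : Fin 6 → ℝ} {p q : ℝ} (hD : p ^ 2 + 4 * q < 0)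
    (h2 : x 2 = p * x 1 + q * x 0) (h3 : x 3 = p * x 2 + q * x 1) (h4 : x 4 = p * x 3 + q * x 2)
    (h5 : x 5 = p * x 4 + q * x 3) (hx : 0 ≤ quadricsDiscrim x) : x = 0 := by
  have hdisc : quadricsDiscrim x =
      (x 1 ^ 2 - p * x 0 * x 1 - q * x 0 ^ 2) ^ 2 * (p ^ 2 + 4 * q) ^ 3 := by
    rw [quadricsDiscrim, h5, h4, h3, h2]; ring
  have hN : x 1 ^ 2 - p * x 0 * x 1 - q * x 0 ^ 2 = 0 := by
    by_contra hN
    have := mul_neg_of_pos_of_neg (by positivity : 0 < (x 1 ^ 2 - p * x 0 * x 1 - q * x 0 ^ 2) ^ 2)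
      (Odd.pow_neg (by decide : Odd 3) hD)
    linarith
  have h0 : x 0 = 0 := by
    by_contra h0
    have : 0 < x 0 ^ 2 := by positivity
    nlinarith [sq_nonneg (2 * x 1 - p * x 0)]
  have h1 : x 1 = 0 := by simpa [h0] using hN
  ext i
  fin_cases i <;> simp [h5, h4, h3, h2, h1, h0]

/-- A binary quintic lies in the real rank two cone if and only if all 3×3 minors of its
Hankel matrix vanish and `Q₁² − 4 Q₀ Q₂ ≥ 0`, where `Q₀, Q₁, Q₂` are the three quadrics
generating the ideal of the tangential variety. -/
theorem realRankTwo_binaryQuintics_iff (x : Fin 6 → ℝ) :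
    x ∈ closure {v : Fin 6 → ℝ |
        ∃ l m a b c e : ℝ, ∀ i : Fin 6,
          v i = l * a ^ (5 - (i : ℕ)) * b ^ (i : ℕ) + m * c ^ (5 - (i : ℕ)) * e ^ (i : ℕ)}
    ↔ ((∀ cols : Fin 3 → Fin 4, ((hankel5 x).submatrix id cols).det = 0)
      ∧ 0 ≤ (2 * x 2 * x 3 - 3 * x 1 * x 4 + x 0 * x 5) ^ 2
          - 4 * (3 * (x 2)^2 - 4 * x 1 * x 3 + x 0 * x 4)
              * (3 * (x 3)^2 - 4 * x 2 * x 4 + x 1 * x 5)) := by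
  change x ∈ closure sumsOfTwoFifthPowers ↔ _ ∧ 0 ≤ quadricsDiscrim x
  constructor
  · intro hx
    have hdisc : Continuous quadricsDiscrim := by unfold quadricsDiscrim; fun_prop
    refine ⟨fun cols => ?_, closure_minimal (t := {v | 0 ≤ quadricsDiscrim v})
      (fun v hv => quadricsDiscrim_nonneg hv) (isClosed_le continuous_const hdisc) hx⟩
    have hdet : Continuous fun v => ((hankel5 v).submatrix id cols).det := by
      refine Continuous.matrix_det (continuous_matrix fun i j => ?_)
      simp only [Matrix.submatrix_apply, hankel5]
      fun_prop
    exact closure_minimal (t := {v | ((hankel5 v).submatrix id cols).det = 0})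
      (fun v hv => hankel5_det_eq_zero hv cols) (isClosed_eq hdet continuous_const) hx
  · rintro ⟨hdet, hx⟩
    obtain ⟨u, hu, e0, e1, e2, e3⟩ := exists_recurrence hdet
    by_cases hu2 : u 2 = 0
    · by_cases hu1 : u 1 = 0
      · have hu0 : u 0 ≠ 0 := fun hu0 => hu (by ext i; fin_cases i <;> simp [hu0, hu1, hu2])
        simp only [hu1, hu2, zero_mul, add_zero, mul_eq_zero, hu0, false_or] at e0 e1 e2 e3
        exact mem_closure_of_coeff_eq_zero e0 e1 e2 e3
      · obtain ⟨r, hr⟩ : ∃ r, u 0 = -(r * u 1) := ⟨-(u 0 / u 1), by field_simp⟩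
        have step : ∀ {a b c : ℝ}, u 0 * a + u 1 * b + u 2 * c = 0 → b = r * a := by
          intro a b c h
          refine mul_left_cancel₀ hu1 ?_
          rw [hu2, hr] at h
          linarith
        refine subset_closure (mem_sumsOfTwoFifthPowers.2
          ⟨x 0, x 5 - x 0 * r ^ 5, 1, r, 0, 1, ?_⟩)
        rw [step e3, step e2, step e1, step e0]
        refine ⟨?_, ?_, ?_, ?_, ?_, ?_⟩ <;> ring
    · obtain ⟨p, hp⟩ : ∃ p, u 1 = -(p * u 2) := ⟨-(u 1 / u 2), by field_simp⟩
      obtain ⟨q, hq⟩ : ∃ q, u 0 = -(q * u 2) := ⟨-(u 0 / u 2), by field_simp⟩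
      have step : ∀ {a b c : ℝ}, u 0 * a + u 1 * b + u 2 * c = 0 → c = p * b + q * a := by
        intro a b c h
        refine mul_left_cancel₀ hu2 ?_
        rw [hp, hq] at h
        linarith
      rcases le_or_gt 0 (p ^ 2 + 4 * q) with hD | hD
      · exact mem_closure_of_recurrence_s10 hD (step e0) (step e1) (step e2) (step e3)
      · rw [eq_zero_of_recurrence hD (step e0) (step e1) (step e2) (step e3) hx]
        exact subset_closure (mem_sumsOfTwoFifthPowers.2 ⟨0, 0, 0, 0, 0, 0, by simp⟩)
end

section
/- Let a, b, c, p, q, r : Fin 2 → ℝ and define the 2×2×2 real tensor T by T i j k = p i * b j * c k + a i * q j * c k + a i * b j * r k. Then Det(T) = 0; that is, the hyperdeterminant vanishes on the tangential variety of the Segre variety ℙ¹×ℙ¹×ℙ¹. -/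
/-- The hyperdeterminant vanishes on the tangential variety of the Segre variety
ℙ¹×ℙ¹×ℙ¹. -/
theorem hyperdet_vanishes_on_tangential_Segre
    (a b c p q r : Fin 2 → ℝ) (T : Fin 2 → Fin 2 → Fin 2 → ℝ)
    (hT : ∀ i j k, T i j k = p i * b j * c k + a i * q j * c k + a i * b j * r k) :
    Det222 T = 0 := by
  simp only [Det222, hT]
  ring
end

section
/- Let d ≥ 3 and n : Fin d → ℕ with n i ≥ 1 for all i. Let x and y be families with x i, y i : Fin (n i) → ℝ, and define the real tensor T : (∀ i : Fin d, Fin (n i)) → ℝ by T j = ∑ i, ( y i (j i) * ∏_{k ≠ i} x k (j k) ). Then every 2×2×2 sub-hyperdeterminant of T equals zero; that is, all 2×2×2 sub-hyperdeterminants vanish on the tangential variety of the Segre variety of arbitrary format. -/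
/-- The Leibniz sum over `insert a s` splits off the factor at `a`. -/
theorem Finset.sum_mul_prod_erase_insert {ι R : Type*} [DecidableEq ι] [CommSemiring R]
    (f g : ι → R) {a : ι} {s : Finset ι} (ha : a ∉ s) :
    ∑ i ∈ insert a s, g i * ∏ k ∈ (insert a s).erase i, f k =
      g a * ∏ k ∈ s, f k + f a * ∑ i ∈ s, g i * ∏ k ∈ s.erase i, f k := by
  rw [Finset.sum_insert ha, Finset.erase_insert ha, Finset.mul_sum]
  congr 1
  refine Finset.sum_congr rfl fun i hi => ?_
  have hia : a ≠ i := fun h => ha (h ▸ hi)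
  rw [Finset.erase_insert_of_ne hia,
    Finset.prod_insert fun h => ha (Finset.mem_of_mem_erase h)]
  ring

/-- The hyperdeterminant vanishes on tangent vectors to the cone over the Segre variety. -/
theorem Det222_tangent (a b c a' b' c' : Fin 2 → ℝ) :
    Det222 (fun p q r => a' p * b q * c r + a p * b' q * c r + a p * b q * c' r) = 0 := by
  simp only [Det222]
  ring

/-- All 2×2×2 sub-hyperdeterminants vanish on the tangential variety of the Segre variety
of arbitrary format. -/
theorem subhyperdets_vanish_on_tangential_Segre
    (d : ℕ) (hd : 3 ≤ d) (n : Fin d → ℕ) (hn : ∀ i, 1 ≤ n i)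
    (x y : ∀ i : Fin d, Fin (n i) → ℝ)
    (T : (∀ i : Fin d, Fin (n i)) → ℝ)
    (hT : ∀ j, T j = ∑ i, (y i (j i) * ∏ k ∈ Finset.univ.erase i, x k (j k))) :
    ∀ (i₁ i₂ i₃ : Fin d), i₁ ≠ i₂ → i₁ ≠ i₃ → i₂ ≠ i₃ →
      ∀ (u : Fin 2 → Fin (n i₁)) (v : Fin 2 → Fin (n i₂)) (w : Fin 2 → Fin (n i₃)),
        u 0 ≠ u 1 → v 0 ≠ v 1 → w 0 ≠ w 1 →
        ∀ j₀ : ∀ i : Fin d, Fin (n i),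
          Det222 (subTensor222 T i₁ i₂ i₃ u v w j₀) = 0 := by
  intro i₁ i₂ i₃ h₁₂ h₁₃ h₂₃ u v w _ _ _ j₀
  let R : Finset (Fin d) := ((Finset.univ.erase i₁).erase i₂).erase i₃
  have h₃ : i₃ ∉ R := by simp [R]
  have h₂ : i₂ ∉ insert i₃ R := by simp [R, h₂₃]
  have h₁ : i₁ ∉ insert i₂ (insert i₃ R) := by simp [R, h₁₂, h₁₃]
  have hR : (Finset.univ : Finset (Fin d)) = insert i₁ (insert i₂ (insert i₃ R)) := by
    ext i
    simp only [R, Finset.mem_insert, Finset.mem_erase, Finset.mem_univ]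
    tauto
  let P : ℝ := ∏ k ∈ R, x k (j₀ k)
  let S : ℝ := ∑ i ∈ R, y i (j₀ i) * ∏ k ∈ R.erase i, x k (j₀ k)
  have key : subTensor222 T i₁ i₂ i₃ u v w j₀ = fun p q r =>
      (P * y i₁ (u p) + S * x i₁ (u p)) * x i₂ (v q) * x i₃ (w r)
        + x i₁ (u p) * (P * y i₂ (v q)) * x i₃ (w r)
        + x i₁ (u p) * x i₂ (v q) * (P * y i₃ (w r)) := by
    funext p q r
    rw [subTensor222, hT]
    set j := Function.update (Function.update (Function.update j₀ i₁ (u p)) i₂ (v q)) i₃ (w r)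
      with hj
    have hj₁ : j i₁ = u p := by simp [hj, h₁₂, h₁₃]
    have hj₂ : j i₂ = v q := by simp [hj, h₂₃]
    have hj₃ : j i₃ = w r := by simp [hj]
    have hjR : ∀ k ∈ R, j k = j₀ k := by
      intro k hk
      simp only [R, Finset.mem_erase] at hk
      simp [hj, hk.1, hk.2.1, hk.2.2.1]
    have hP : ∏ k ∈ R, x k (j k) = P :=
      Finset.prod_congr rfl fun k hk => by rw [hjR k hk]
    have hS : ∑ i ∈ R, y i (j i) * ∏ k ∈ R.erase i, x k (j k) = S := by
      refine Finset.sum_congr rfl fun i hi => ?_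
      rw [hjR i hi]
      congr 1
      exact Finset.prod_congr rfl fun k hk => by rw [hjR k (Finset.mem_of_mem_erase hk)]
    rw [hR, Finset.sum_mul_prod_erase_insert (fun k => x k (j k)) (fun k => y k (j k)) h₁,
      Finset.sum_mul_prod_erase_insert (fun k => x k (j k)) (fun k => y k (j k)) h₂,
      Finset.sum_mul_prod_erase_insert (fun k => x k (j k)) (fun k => y k (j k)) h₃,
      Finset.prod_insert h₂, Finset.prod_insert h₃, hP, hS, hj₁, hj₂, hj₃]
    ring
  rw [key]
  exact Det222_tangent (fun p => x i₁ (u p)) (fun q => x i₂ (v q)) (fun r => x i₃ (w r))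
    (fun p => P * y i₁ (u p) + S * x i₁ (u p)) (fun q => P * y i₂ (v q))
    (fun r => P * y i₃ (w r))
end

section
/- Let n₁, n₂, n₃ ≥ 1 and let a, d : Fin n₁ → ℝ, b, e : Fin n₂ → ℝ, c, f : Fin n₃ → ℝ. Define the real tensor T : Fin n₁ → Fin n₂ → Fin n₃ → ℝ by T i j k = a i * b j * c k + d i * e j * f k. Then for all i₁, i₂ ∈ Fin n₁, j₁, j₂ ∈ Fin n₂, k₁, k₂ ∈ Fin n₃, the hyperdeterminant of the 2×2×2 sub-tensor T' defined by T' p q r = T i_p j_q k_r (for p, q, r ∈ {1,2}) equals (a i₁ * d i₂ − a i₂ * d i₁)² * (b j₁ * e j₂ − b j₂ * e j₁)² * (c k₁ * f k₂ − c k₂ * f k₁)². -/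
/-- For a real rank-two tensor of format n₁×n₂×n₃, each 2×2×2 sub-hyperdeterminant is the
product of the squares of the corresponding 2×2 minors of the three parameter pairs. -/
theorem subhyperdet_of_rank_two_tensor
    (n₁ n₂ n₃ : ℕ) (hn₁ : 1 ≤ n₁) (hn₂ : 1 ≤ n₂) (hn₃ : 1 ≤ n₃)
    (a d : Fin n₁ → ℝ) (b e : Fin n₂ → ℝ) (c f : Fin n₃ → ℝ)
    (T : Fin n₁ → Fin n₂ → Fin n₃ → ℝ)
    (hT : ∀ i j k, T i j k = a i * b j * c k + d i * e j * f k) :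
    ∀ (i₁ i₂ : Fin n₁) (j₁ j₂ : Fin n₂) (k₁ k₂ : Fin n₃),
      Det222 (fun p q r => T (![i₁, i₂] p) (![j₁, j₂] q) (![k₁, k₂] r)) =
        (a i₁ * d i₂ - a i₂ * d i₁)^2 * (b j₁ * e j₂ - b j₂ * e j₁)^2 *
          (c k₁ * f k₂ - c k₂ * f k₁)^2 := by
  intro i₁ i₂ j₁ j₂ k₁ k₂
  simp only [Det222, hT, Matrix.cons_val_zero, Matrix.cons_val_one]
  ring
end

section
/- For all real numbers s₁, t₁, s₂, t₂, λ, μ satisfying (s₁t₂ + s₂t₁)² + 2 s₁s₂t₁t₂ = 0, setting w = λs₁⁴ + μs₂⁴, x = λs₁³t₁ + μs₂³t₂, y = λs₁t₁³ + μs₂t₂³, z = λt₁⁴ + μt₂⁴ (so that (w,x,y,z) lies on the secant line of the monomial curve (s⁴, s³t, st³, t⁴) through the points with parameters (s₁ : t₁) and (s₂ : t₂)), one has 32x³y³ − 27w²y⁴ − 6wx²y²z − 27x⁴z² + 24w²xyz² + 4w³z³ = 0. That is, this sextic polynomial vanishes on the edge surface of the curve (s⁴ : s³t : st³ : t⁴)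 in ℙ³. -/
/-- The sextic `32x³y³ − 27w²y⁴ − 6wx²y²z − 27x⁴z² + 24w²xyz² + 4w³z³` vanishes on the
edge surface of the monomial curve `(s⁴ : s³t : st³ : t⁴)` in ℙ³: it vanishes at every
point of a secant line whose parameters satisfy `Φ(a,b,c) = b² + 2ac = 0`. -/
theorem sextic_vanishes_on_edge_surface
    (s₁ t₁ s₂ t₂ lam mu w x y z : ℝ)
    (hΦ : (s₁ * t₂ + s₂ * t₁)^2 + 2 * (s₁ * s₂) * (t₁ * t₂) = 0)
    (hw : w = lam * s₁^4 + mu * s₂^4)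
    (hx : x = lam * s₁^3 * t₁ + mu * s₂^3 * t₂)
    (hy : y = lam * s₁ * t₁^3 + mu * s₂ * t₂^3)
    (hz : z = lam * t₁^4 + mu * t₂^4) :
    32 * x^3 * y^3 - 27 * w^2 * y^4 - 6 * w * x^2 * y^2 * z
      - 27 * x^4 * z^2 + 24 * w^2 * x * y * z^2 + 4 * w^3 * z^3 = 0 := by
  subst hw hx hy hz
  linear_combination
    (lam^4 * mu^2 *
        (9 * s₁^10 * t₁^4 * t₂^6 - 81 * s₁^8 * t₁^6 * s₂^2 * t₂^4
          + 144 * s₁^7 * t₁^7 * s₂^3 * t₂^3 - 81 * s₁^6 * t₁^8 * s₂^4 * t₂^2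
          + 9 * s₁^4 * t₁^10 * s₂^6)
      + lam^3 * mu^3 *
        (4 * s₁^10 * t₂^10 + 8 * s₁^9 * t₁ * s₂ * t₂^9 - 42 * s₁^8 * t₁^2 * s₂^2 * t₂^8
          + 150 * s₁^6 * t₁^4 * s₂^4 * t₂^6 - 240 * s₁^5 * t₁^5 * s₂^5 * t₂^5
          + 150 * s₁^4 * t₁^6 * s₂^6 * t₂^4 - 42 * s₁^2 * t₁^8 * s₂^8 * t₂^2
          + 8 * s₁ * t₁^9 * s₂^9 * t₂ + 4 * t₁^10 * s₂^10)
      + lam^2 * mu^4 *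
        (9 * s₁^6 * s₂^4 * t₂^10 - 81 * s₁^4 * t₁^2 * s₂^6 * t₂^8
          + 144 * s₁^3 * t₁^3 * s₂^7 * t₂^7 - 81 * s₁^2 * t₁^4 * s₂^8 * t₂^6
          + 9 * t₁^6 * s₂^10 * t₂^4)) * hΦ
end
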